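/- Let λ > 0 and μ ∈ ℝ, define Φ_{λ,μ}(z) = λ·Σ_{j≥1}(1/j)Σ_{p₁,p₂ prime} z^{p₁p₂j} + μ·Σ_{j≥1}(1/j)Σ_{p prime} z^{p²j}, Ψ_{λ,μ}(z) = exp(Φ_{λ,μ}(z)) = Σ_{n≥0} 𝔭_{λ,μ}(n)·zⁿ, and for large n let ρ = ρ(n) ∈ (0,1) be the solution of n = ρ·Φ'_{λ,μ}(ρ). Then as n → ∞, 𝔭_{λ,μ}(n) = (ρ^{−n}·Ψ_{λ,μ}(ρ)) / (2π·Φ_{λ,μ,(2)}(ρ))^{1/2} · (1 + O(n^{−1/6})), where Φ_{λ,μ,(2)}(ρ) = (ρ d/dρ)² Φ_{λ,μ}(ρ). -/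

import Mathlib

open Filter Real Topology

noncomputable section

/-- `Φ_{P₂}(z) = Σ_{j ≥ 1} (1/j) Σ_{p₁, p₂ prime} z^{p₁p₂j}` (real version). -/
def PhiP2 (z : ℝ) : ℝ :=
  ∑' (j : ℕ+) (p : Nat.Primes) (q : Nat.Primes),
    (1 / (j : ℝ)) * z ^ ((p : ℕ) * (q : ℕ) * (j : ℕ))

/-- `Φ_{P²}(z) = Σ_{j ≥ 1} (1/j) Σ_{p prime} z^{p²j}` (real version). -/
def PhiPsq (z : ℝ) : ℝ :=
  ∑' (j : ℕ+) (p : Nat.Primes), (1 / (j : ℝ)) * z ^ ((p : ℕ)^2 * (j : ℕ))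

/-- `Φ_{P₂}` (complex version). -/
def PhiP2C (z : ℂ) : ℂ :=
  ∑' (j : ℕ+) (p : Nat.Primes) (q : Nat.Primes),
    (1 / (j : ℂ)) * z ^ ((p : ℕ) * (q : ℕ) * (j : ℕ))

/-- `Φ_{P²}` (complex version). -/
def PhiPsqC (z : ℂ) : ℂ :=
  ∑' (j : ℕ+) (p : Nat.Primes), (1 / (j : ℂ)) * z ^ ((p : ℕ)^2 * (j : ℕ))

/-- The operator `ρ · d/dρ`. -/
def Dop (f : ℝ → ℝ) : ℝ → ℝ := fun x => x * deriv f x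

/-- A finite set of naturals whose pairwise differences are multiples of `d` bounded by `W` has at
most `W / d + 1` elements. -/
lemma card_le_of_dvd_sub_of_sub_le (S : Finset ℕ) (d : ℕ) (hd : 0 < d) (W : ℝ) (hW : 0 ≤ W)
    (h : ∀ x ∈ S, ∀ y ∈ S, x ≤ y → d ∣ y - x ∧ ((y - x : ℕ) : ℝ) ≤ W) :
    (S.card : ℝ) ≤ W / d + 1 := by
  rcases S.eq_empty_or_nonempty with rfl | hne
  · simp; positivity
  have hd' : (0 : ℝ) < d := by exact_mod_cast hd
  set m := S.min' hne
  have hm : m ∈ S := S.min'_mem hne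
  have key : S.card ≤ (Finset.range (⌊W / d⌋₊ + 1)).card := by
    refine Finset.card_le_card_of_injOn (fun x => (x - m) / d) ?_ ?_
    · intro x hx
      have hmx : m ≤ x := S.min'_le x hx
      obtain ⟨h1, h2⟩ := h m hm x hx hmx
      simp only [Finset.coe_range, Set.mem_Iio]
      rw [Nat.lt_succ_iff]
      apply Nat.le_floor
      rw [Nat.cast_div h1 hd'.ne']
      gcongr
    · intro x hx y hy hxy
      have hmx : m ≤ x := S.min'_le x hx
      have hmy : m ≤ y := S.min'_le y hy
      obtain ⟨h1, -⟩ := h m hm x hx hmx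
      obtain ⟨h2, -⟩ := h m hm y hy hmy
      have := (Nat.div_left_inj h1 h2).1 hxy
      omega
  rw [Finset.card_range] at key
  calc (S.card : ℝ) ≤ ((⌊W / d⌋₊ + 1 : ℕ) : ℝ) := by exact_mod_cast key
    _ ≤ W / d + 1 := by
      push_cast
      gcongr
      exact Nat.floor_le (by positivity)

/-- If `a / d` is in lowest terms and `D * (a / d)` is within `1 / d` of an integer `k`, then `d`
divides `D` and the distance is zero. -/
lemma dvd_of_abs_mul_rat_sub_lt (r : ℚ) (D : ℕ) (k : ℤ) (h : |(D : ℝ) * r - k| * r.den < 1) :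
    r.den ∣ D ∧ (D : ℝ) * r = k := by
  have hd : (0 : ℝ) < r.den := by exact_mod_cast r.pos
  have hr : (r : ℝ) * r.den = r.num := by
    exact_mod_cast Rat.mul_den_eq_num r
  have h1 : |(((D : ℤ) * r.num - k * r.den : ℤ) : ℝ)| < 1 := by
    rw [← abs_of_pos hd, ← abs_mul] at h
    have h0 : (((D : ℤ) * r.num - k * r.den : ℤ) : ℝ) = ((D : ℝ) * r - k) * r.den := by
      push_cast
      rw [← hr]; ring
    rwa [h0]
  have h2 : (D : ℤ) * r.num - k * r.den = 0 := by
    rw [← Int.abs_lt_one_iff]; exact_mod_cast h1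
  constructor
  · have h3 : (r.den : ℤ) ∣ (D : ℤ) * r.num := ⟨k, by linarith⟩
    have h4 : IsCoprime (r.den : ℤ) r.num := by
      rw [Int.isCoprime_iff_gcd_eq_one]
      have := r.reduced
      rw [Int.gcd_comm]
      exact this
    exact_mod_cast h4.dvd_of_dvd_mul_right h3
  · have h5 : ((D : ℝ) * r - k) * r.den = 0 := by
      have : (((D : ℤ) * r.num - k * r.den : ℤ) : ℝ) = 0 := by rw [h2]; simp
      push_cast at this
      rw [← hr] at this
      linarith
    rcases mul_eq_zero.1 h5 with h | h
    · linarith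
    · exact absurd h hd.ne'

/-- If `β q` is within `η` of an integer for all `q` in a large set of primes up to `Y`, then `β`
itself is very close to an integer. -/
lemma exists_int_near_of_primes_near (G : Finset ℕ) (hG : ∀ q ∈ G, q.Prime) (Y η β : ℝ) (N : ℕ)
    (hY : ∀ q ∈ G, (q : ℝ) ≤ Y) (hY0 : 0 ≤ Y) (hη : 0 < η) (hN : 0 < N) (hηN : 4 * η * N < 1)
    (hnear : ∀ q ∈ G, ∃ k : ℤ, |(q : ℝ) * β - k| ≤ η)
    (hcard : 8 * η * Y + 2 * Y / N + 1 < G.card) (hcard' : N + 1 < G.card) :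
    ∃ k : ℤ, |β - k| * ((G.card : ℝ) - 1) ≤ 2 * η := by
  obtain ⟨r, hr, hrN⟩ := Real.exists_rat_abs_sub_le_and_den_le β hN
  set d := r.den with hd_def
  have hd : (0 : ℝ) < d := by exact_mod_cast r.pos
  have hd1 : (1 : ℝ) ≤ d := by exact_mod_cast r.pos
  have hrN' : (d : ℝ) ≤ N := by exact_mod_cast hrN
  have hN' : (0 : ℝ) < N := by exact_mod_cast hN
  set ε := β - r with hε
  have hηd : 4 * η * d < 1 := lt_of_le_of_lt (by gcongr) hηN
  have pair : ∀ x ∈ G, ∀ y ∈ G, x ≤ y → ((y - x : ℕ) : ℝ) * (d * |ε|) ≤ 1 / 2 →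
      d ∣ y - x ∧ ((y - x : ℕ) : ℝ) * |ε| ≤ 2 * η := by
    intro x hx y hy hxy hs
    obtain ⟨k, hk⟩ := hnear x hx
    obtain ⟨l, hl⟩ := hnear y hy
    have hkl : |((y - x : ℕ) : ℝ) * β - ((l - k : ℤ) : ℝ)| ≤ 2 * η := by
      rw [Nat.cast_sub hxy]; push_cast
      rw [abs_le] at hk hl ⊢
      constructor <;> linarith [hk.1, hk.2, hl.1, hl.2]
    have hβ : β = r + ε := by rw [hε]; ring
    have h1 : |((y - x : ℕ) : ℝ) * r - ((l - k : ℤ) : ℝ)| * d < 1 := by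
      have : |((y - x : ℕ) : ℝ) * r - ((l - k : ℤ) : ℝ)| ≤ 2 * η + ((y - x : ℕ) : ℝ) * |ε| := by
        have h2 : ((y - x : ℕ) : ℝ) * r - ((l - k : ℤ) : ℝ) =
          (((y - x : ℕ) : ℝ) * β - ((l - k : ℤ) : ℝ)) - ((y - x : ℕ) : ℝ) * ε := by
          rw [hβ]; ring
        rw [h2]
        refine (abs_sub _ _).trans ?_
        rw [abs_mul, Nat.abs_cast]
        gcongr
      calc _ ≤ (2 * η + ((y - x : ℕ) : ℝ) * |ε|) * d := by gcongr
        _ = (4 * η * d) / 2 + ((y - x : ℕ) : ℝ) * (d * |ε|) := by ring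
        _ < 1 := by linarith
    obtain ⟨h2, h3⟩ := dvd_of_abs_mul_rat_sub_lt r _ _ h1
    refine ⟨h2, ?_⟩
    rw [hβ, mul_add, h3] at hkl
    simpa [abs_mul] using hkl
  by_cases hcase : Y * (d * |ε|) ≤ 1 / 2
  · have hcl : ((G.card : ℝ) - 1) * (d * |ε|) ≤ 2 * η := by
      rcases eq_or_ne ε 0 with h0 | h0
      · rw [h0]; simp; positivity
      have hε0 : 0 < |ε| := abs_pos.2 h0
      have := card_le_of_dvd_sub_of_sub_le G d r.pos (2 * η / |ε|) (by positivity) (by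
        intro x hx y hy hxy
        have hle : ((y - x : ℕ) : ℝ) ≤ Y :=
          le_trans (by exact_mod_cast Nat.sub_le y x) (hY y hy)
        obtain ⟨h1, h2⟩ := pair x hx y hy hxy (le_trans (by gcongr) hcase)
        exact ⟨h1, by rwa [le_div_iff₀ hε0]⟩)
      calc ((G.card : ℝ) - 1) * (d * |ε|) ≤ (2 * η / |ε| / d) * (d * |ε|) := by
            gcongr; linarith
        _ = 2 * η := by field_simp
    obtain ⟨q, hq, hqN⟩ : ∃ q ∈ G, N < q := by
      by_contra! hcon
      have : G ⊆ Finset.range (N + 1) := fun q hq => by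
        simpa [Nat.lt_succ_iff] using hcon q hq
      have := Finset.card_le_card this
      rw [Finset.card_range] at this
      omega
    obtain ⟨k, hk⟩ := hnear q hq
    have h1 : |(q : ℝ) * r - k| * d < 1 := by
      have : |(q : ℝ) * r - k| ≤ η + Y * |ε| := by
        have h2 : (q : ℝ) * r - k = ((q : ℝ) * β - k) - q * ε := by rw [hε]; ring
        rw [h2]
        refine (abs_sub _ _).trans ?_
        rw [abs_mul, Nat.abs_cast]
        gcongr
        exact hY q hq
      calc _ ≤ (η + Y * |ε|) * d := by gcongr
        _ = (4 * η * d) / 4 + Y * (d * |ε|) := by ring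
        _ < 1 := by linarith
    obtain ⟨h2, -⟩ := dvd_of_abs_mul_rat_sub_lt r _ _ h1
    have hd_one : d = 1 := by
      rcases (Nat.dvd_prime (hG q hq)).1 h2 with h | h
      · exact h
      · omega
    refine ⟨r.num, ?_⟩
    have hrn : (r : ℝ) = r.num := by
      have : r = (r.num : ℚ) := by
        rw [Rat.coe_int_num_of_den_eq_one hd_one]
      exact_mod_cast congrArg (fun x : ℚ => (x : ℝ)) this
    rw [← hrn, ← hε]
    rw [hd_one] at hcl
    simp only [Nat.cast_one, one_mul] at hcl
    linarith
  · exfalso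
    push Not at hcase
    have hdε : 0 < d * |ε| := by
      by_contra! h
      have := mul_nonpos_of_nonneg_of_nonpos hY0 h
      linarith
    have hε0 : 0 < |ε| := by
      rcases (abs_nonneg ε).eq_or_lt with h | h
      · rw [← h] at hdε; simp at hdε
      · exact h
    set K := 1 / (2 * (d * |ε|)) with hK
    have hK0 : 0 < K := by positivity
    have hKY : K ≤ Y := by
      rw [hK, div_le_iff₀ (by positivity)]; linarith
    have hKε : K * (d * |ε|) = 1 / 2 := by rw [hK]; field_simp
    have hKN : N / 2 ≤ K := by
      rw [hK, div_le_div_iff₀ (by norm_num) (by positivity)]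
      have : (d * |ε|) * (N + 1) ≤ 1 := by
        rw [le_div_iff₀ (by positivity)] at hr
        linarith
      nlinarith
    have hfib : ∀ b ∈ G.image (fun q : ℕ => ⌊(q : ℝ) / K⌋₊),
        (G.filter (fun q : ℕ => ⌊(q : ℝ) / K⌋₊ = b)).card ≤ ⌊4 * η * K + 1⌋₊ := by
      intro b _
      apply Nat.le_floor
      have := card_le_of_dvd_sub_of_sub_le (G.filter (fun q : ℕ => ⌊(q : ℝ) / K⌋₊ = b)) d r.pos
        (2 * η / |ε|) (by positivity) (by
        intro x hx y hy hxy
        simp only [Finset.mem_filter] at hx hy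
        have hxb : (b : ℝ) ≤ x / K := by
          rw [← hx.2]; exact Nat.floor_le (by positivity)
        have hyb : y / K < (b : ℝ) + 1 := by
          rw [← hy.2]; exact Nat.lt_floor_add_one _
        rw [le_div_iff₀ hK0] at hxb
        rw [div_lt_iff₀ hK0] at hyb
        have hle : ((y - x : ℕ) : ℝ) ≤ K := by
          rw [Nat.cast_sub hxy]; linarith
        obtain ⟨h1, h2⟩ := pair x hx.1 y hy.1 hxy (by rw [← hKε]; gcongr)
        exact ⟨h1, by rwa [le_div_iff₀ hε0]⟩)
      refine this.trans (le_of_eq ?_)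
      rw [hK]; field_simp; ring
    have h1 := Finset.card_le_mul_card_image (s := G) (f := fun q : ℕ => ⌊(q : ℝ) / K⌋₊) _ hfib
    have h2 : (G.image (fun q : ℕ => ⌊(q : ℝ) / K⌋₊)).card ≤ ⌊Y / K⌋₊ + 1 := by
      rw [← Finset.card_range (⌊Y / K⌋₊ + 1)]
      apply Finset.card_le_card
      intro b hb
      obtain ⟨q, hq, rfl⟩ := Finset.mem_image.1 hb
      rw [Finset.mem_range, Nat.lt_succ_iff]
      apply Nat.floor_mono
      gcongr
      exact hY q hq
    have h3 : (G.card : ℝ) ≤ (4 * η * K + 1) * (Y / K + 1) := by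
      calc (G.card : ℝ) ≤ (⌊4 * η * K + 1⌋₊ : ℝ) * ((⌊Y / K⌋₊ + 1 : ℕ) : ℝ) := by
            exact_mod_cast h1.trans (by gcongr)
        _ ≤ _ := by
            push_cast
            gcongr
            · exact Nat.floor_le (by positivity)
            · exact Nat.floor_le (by positivity)
    have h4 : (4 * η * K + 1) * (Y / K + 1) = 4 * η * Y + Y / K + 4 * η * K + 1 := by
      field_simp; ring
    have h5 : Y / K ≤ 2 * Y / N := by
      rw [div_le_div_iff₀ hK0 hN']; nlinarith
    have h6 : 4 * η * K ≤ 4 * η * Y := by gcongr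
    linarith

/-- Index set of the triple series: `(j, p, q)` stands for the term `z ^ (p q j) / j`. -/
abbrev TripleIdx : Type := ℕ+ × Nat.Primes × Nat.Primes

/-- The exponent `p q j` attached to `(j, p, q)`. -/
def tripleDeg (i : TripleIdx) : ℕ := (i.2.1 : ℕ) * (i.2.2 : ℕ) * (i.1 : ℕ)

/-- The coefficient attached to `(j, p, q)` in `λ Φ_{P₂} + μ Φ_{P²}`. -/
def tripleCoeff (lam mu : ℝ) (i : TripleIdx) : ℝ :=
  (lam + if i.2.1 = i.2.2 then mu else 0) / (i.1 : ℝ)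

lemma tripleDeg_one (p q : Nat.Primes) : tripleDeg (1, p, q) = p * q := by
  simp [tripleDeg]

lemma tripleDeg_pos (i : TripleIdx) : 0 < tripleDeg i :=
  Nat.mul_pos (Nat.mul_pos i.2.1.2.pos i.2.2.2.pos) i.1.pos

lemma one_le_tripleDeg (i : TripleIdx) : (1 : ℝ) ≤ tripleDeg i := by
  exact_mod_cast tripleDeg_pos i

lemma one_le_pnat_cast (j : ℕ+) : (1 : ℝ) ≤ (j : ℝ) := by
  exact_mod_cast j.pos

lemma abs_tripleCoeff_le (lam mu : ℝ) (i : TripleIdx) :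
    |tripleCoeff lam mu i| ≤ |lam| + |mu| := by
  have hj := one_le_pnat_cast i.1
  rw [tripleCoeff, abs_div, abs_of_pos (by linarith : (0 : ℝ) < (i.1 : ℝ))]
  refine (div_le_self (abs_nonneg _) hj).trans ((abs_add_le _ _).trans ?_)
  have h : |if i.2.1 = i.2.2 then mu else 0| ≤ |mu| := by
    split_ifs
    · exact le_rfl
    · simp
  linarith

lemma exp_neg_le_mul_rpow {s x : ℝ} (hs : 0 < s) (hx : 0 < x) :
    Real.exp (-x) ≤ s ^ s * x ^ (-s) := by
  have h1 : x / s ≤ Real.exp (x / s) := by linarith [Real.add_one_le_exp (x / s)]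
  have h2 : (x / s) ^ s ≤ Real.exp x := by
    calc (x / s) ^ s ≤ (Real.exp (x / s)) ^ s := by gcongr
      _ = Real.exp x := by rw [← Real.exp_mul]; congr 1; field_simp
  rw [Real.div_rpow hx.le hs.le] at h2
  have h3 : 0 < x ^ s := by positivity
  have h4 : 0 < s ^ s := by positivity
  rw [Real.exp_neg, Real.rpow_neg hx.le, ← div_eq_mul_inv, inv_eq_one_div,
    div_le_div_iff₀ (Real.exp_pos _) h3]
  rw [div_le_iff₀ h4] at h2
  linarith

lemma pow_mul_exp_neg_le (k : ℕ) {s t m : ℝ} (hs : 0 < s) (ht : 0 < t) (hm : 0 < m) :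
    m ^ k * Real.exp (-(m * t)) ≤ s ^ s * t ^ (-s) * m ^ ((k : ℝ) - s) := by
  have h := exp_neg_le_mul_rpow hs (mul_pos hm ht)
  rw [Real.mul_rpow hm.le ht.le] at h
  rw [sub_eq_add_neg, Real.rpow_add hm, Real.rpow_natCast]
  calc _ ≤ m ^ k * (s ^ s * (m ^ (-s) * t ^ (-s))) := by gcongr
    _ = _ := by ring

lemma summable_pnat_rpow {σ : ℝ} (hσ : 1 < σ) : Summable (fun j : ℕ+ => (j : ℝ) ^ (-σ)) :=
  (Real.summable_nat_rpow.2 (by linarith)).comp_injective PNat.coe_injective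

lemma summable_primes_rpow {σ : ℝ} (hσ : 1 < σ) :
    Summable (fun p : Nat.Primes => (p : ℝ) ^ (-σ)) :=
  (Real.summable_nat_rpow.2 (by linarith)).comp_injective Nat.Primes.coe_nat_injective

lemma tripleDeg_rpow (i : TripleIdx) (σ : ℝ) :
    (tripleDeg i : ℝ) ^ σ = (i.1 : ℝ) ^ σ * ((i.2.1 : ℝ) ^ σ * (i.2.2 : ℝ) ^ σ) := by
  rw [tripleDeg]
  push_cast
  rw [Real.mul_rpow (by positivity) (by positivity), Real.mul_rpow (by positivity) (by positivity)]
  ring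

lemma summable_tripleDeg_rpow {σ : ℝ} (hσ : 1 < σ) :
    Summable (fun i : TripleIdx => (tripleDeg i : ℝ) ^ (-σ)) := by
  simp_rw [tripleDeg_rpow]
  exact (summable_pnat_rpow hσ).mul_of_nonneg
    ((summable_primes_rpow hσ).mul_of_nonneg (summable_primes_rpow hσ)
      (fun _ => by positivity) (fun _ => by positivity))
    (fun _ => by positivity) (fun _ => by simp only [Pi.zero_apply]; positivity)

lemma summable_diag_tripleDeg_rpow :
    Summable (fun i : TripleIdx =>
      if i.2.1 = i.2.2 then (tripleDeg i : ℝ) ^ (-(3 / 4 : ℝ)) / (i.1 : ℝ) else 0) := by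
  have hinj : Function.Injective (fun x : ℕ+ × Nat.Primes => ((x.1, x.2, x.2) : TripleIdx)) := by
    rintro ⟨a, b⟩ ⟨c, d⟩ h
    simp only [Prod.mk.injEq] at h ⊢
    exact ⟨h.1, h.2.1⟩
  rw [← hinj.summable_iff]
  · have h1 := (summable_pnat_rpow (σ := 7 / 4) (by norm_num)).mul_of_nonneg
      (summable_primes_rpow (σ := 3 / 2) (by norm_num))
      (fun _ => by positivity) (fun _ => by positivity)
    refine h1.congr fun x => ?_
    have hj : (0 : ℝ) < (x.1 : ℝ) := by exact_mod_cast x.1.pos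
    have hp : (0 : ℝ) < (x.2 : ℝ) := by exact_mod_cast x.2.2.pos
    simp only [Function.comp_apply, if_true, tripleDeg_rpow]
    have e1 : (x.1 : ℝ) ^ (-(7 / 4) : ℝ) = (x.1 : ℝ) ^ (-(3 / 4) : ℝ) / (x.1 : ℝ) := by
      rw [← Real.rpow_sub_one hj.ne']
      norm_num
    have e2 : (x.2 : ℝ) ^ (-(3 / 2) : ℝ) =
        (x.2 : ℝ) ^ (-(3 / 4) : ℝ) * (x.2 : ℝ) ^ (-(3 / 4) : ℝ) := by
      rw [← Real.rpow_add hp]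
      norm_num
    rw [e1, e2]
    ring
  · rintro ⟨j, p, q⟩ hx
    simp only [Set.mem_range, Prod.mk.injEq, Prod.exists, not_exists] at hx
    rw [if_neg]
    intro h
    exact hx j p ⟨rfl, rfl, h⟩

/-- Upper bound for the absolute moments of the triple series. -/
lemma exists_tsum_abs_moment_le (lam mu : ℝ) (k : ℕ) : ∃ C : ℝ, 0 < C ∧ ∀ t : ℝ, 0 < t →
    Summable (fun i => |tripleCoeff lam mu i| *
      ((tripleDeg i : ℝ) ^ k * Real.exp (-(tripleDeg i * t)))) ∧
    ∑' i, |tripleCoeff lam mu i| * ((tripleDeg i : ℝ) ^ k * Real.exp (-(tripleDeg i * t)))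
      ≤ C * t ^ (-((k : ℝ) + 101 / 100)) := by
  set s : ℝ := (k : ℝ) + 101 / 100 with hs_def
  have hs : 0 < s := by positivity
  have hsum := summable_tripleDeg_rpow (σ := 101 / 100) (by norm_num)
  set A := ∑' i : TripleIdx, (tripleDeg i : ℝ) ^ (-(101 / 100 : ℝ)) with hA
  have hA0 : 0 ≤ A := tsum_nonneg fun _ => by positivity
  refine ⟨(|lam| + |mu|) * s ^ s * A + 1, by positivity, fun t ht => ?_⟩
  have hle : ∀ i, |tripleCoeff lam mu i| *
      ((tripleDeg i : ℝ) ^ k * Real.exp (-(tripleDeg i * t))) ≤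
      ((|lam| + |mu|) * s ^ s * t ^ (-s)) * (tripleDeg i : ℝ) ^ (-(101 / 100 : ℝ)) := by
    intro i
    have h1 := pow_mul_exp_neg_le k hs ht (lt_of_lt_of_le one_pos (one_le_tripleDeg i))
    have h2 : (k : ℝ) - s = -(101 / 100 : ℝ) := by rw [hs_def]; ring
    rw [h2] at h1
    calc _ ≤ (|lam| + |mu|) * (s ^ s * t ^ (-s) * (tripleDeg i : ℝ) ^ (-(101 / 100 : ℝ))) := by
          gcongr
          exact abs_tripleCoeff_le lam mu i
      _ = _ := by ring
  have hsum' := hsum.mul_left ((|lam| + |mu|) * s ^ s * t ^ (-s))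
  have hS := Summable.of_nonneg_of_le (fun i => by positivity) hle hsum'
  refine ⟨hS, ?_⟩
  calc _ ≤ _ := hS.tsum_le_tsum hle hsum'
    _ = (|lam| + |mu|) * s ^ s * A * t ^ (-s) := by rw [tsum_mul_left, ← hA]; ring
    _ ≤ _ := by
      gcongr
      linarith

/-- A triple sum with nonnegative weights is bounded below by its part with `j = 1` and a fixed
prime `p₀`, up to the contribution of the diagonal `p = q`. -/
lemma exists_le_tsum_weighted {lam : ℝ} (mu : ℝ) (hlam : 0 < lam) (k : ℕ) :
    ∃ C : ℝ, 0 < C ∧ ∀ t : ℝ, 0 < t → ∀ B : ℝ, 0 ≤ B → ∀ g : TripleIdx → ℝ, (∀ i, 0 ≤ g i) →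
    (∀ i, g i ≤ B * (tripleDeg i : ℝ) ^ k) → ∀ (p₀ : Nat.Primes) (Q : Finset Nat.Primes),
    lam * ∑ q ∈ Q, g (1, p₀, q) * Real.exp (-((p₀ : ℝ) * q * t))
      - C * B * t ^ (-((k : ℝ) + 3 / 4)) ≤
    ∑' i, tripleCoeff lam mu i * (g i * Real.exp (-(tripleDeg i * t))) := by
  set s : ℝ := (k : ℝ) + 3 / 4 with hs_def
  have hs : 0 < s := by positivity
  set A := ∑' i : TripleIdx,
    if i.2.1 = i.2.2 then (tripleDeg i : ℝ) ^ (-(3 / 4 : ℝ)) / (i.1 : ℝ) else 0 with hA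
  have hA0 : 0 ≤ A := tsum_nonneg fun _ => by split_ifs <;> positivity
  refine ⟨|mu| * s ^ s * A + 1, by positivity, fun t ht B hB g hg0 hgB p₀ Q => ?_⟩
  obtain ⟨C', -, hC'⟩ := exists_tsum_abs_moment_le lam mu k
  obtain ⟨hS, -⟩ := hC' t ht
  obtain ⟨C₁, -, hC₁⟩ := exists_tsum_abs_moment_le lam 0 k
  obtain ⟨hS₁, -⟩ := hC₁ t ht
  have hsumm : Summable (fun i => tripleCoeff lam mu i *
      (g i * Real.exp (-(tripleDeg i * t)))) := by
    refine Summable.of_norm_bounded (hS.mul_left B) fun i => ?_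
    rw [Real.norm_eq_abs, abs_mul, abs_of_nonneg (mul_nonneg (hg0 i) (Real.exp_pos _).le)]
    calc _ ≤ |tripleCoeff lam mu i| * (B * (tripleDeg i : ℝ) ^ k *
          Real.exp (-(tripleDeg i * t))) := by
            gcongr
            exact hgB i
      _ = _ := by ring
  set f : TripleIdx → ℝ := fun i => lam / (i.1 : ℝ) * (g i * Real.exp (-(tripleDeg i * t))) with hf
  have hf0 : ∀ i, 0 ≤ f i := fun i =>
    mul_nonneg (by positivity) (mul_nonneg (hg0 i) (Real.exp_pos _).le)
  have hfs : Summable f := by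
    refine Summable.of_nonneg_of_le hf0 (fun i => ?_) (hS₁.mul_left B)
    have h1 : |tripleCoeff lam 0 i| = lam / (i.1 : ℝ) := by
      rw [tripleCoeff]
      simp only [ite_self, add_zero]
      exact abs_of_nonneg (by positivity)
    rw [h1]
    simp only [hf]
    calc _ ≤ lam / (i.1 : ℝ) * (B * (tripleDeg i : ℝ) ^ k *
          Real.exp (-(tripleDeg i * t))) := by
            gcongr
            exact hgB i
      _ = _ := by ring
  set D : TripleIdx → ℝ := fun i => (|mu| * s ^ s * B * t ^ (-s)) *
    (if i.2.1 = i.2.2 then (tripleDeg i : ℝ) ^ (-(3 / 4 : ℝ)) / (i.1 : ℝ) else 0) with hD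
  have hDs : Summable D := summable_diag_tripleDeg_rpow.mul_left _
  have hDt : ∑' i, D i = |mu| * s ^ s * B * t ^ (-s) * A := by rw [hD, tsum_mul_left]
  have hpt : ∀ i, f i - D i ≤ tripleCoeff lam mu i * (g i * Real.exp (-(tripleDeg i * t))) := by
    intro i
    have hj := one_le_pnat_cast i.1
    have hj0 : (0 : ℝ) < (i.1 : ℝ) := by linarith
    simp only [hf, hD, tripleCoeff]
    split_ifs with hpq
    · have h1 := pow_mul_exp_neg_le k hs ht (lt_of_lt_of_le one_pos (one_le_tripleDeg i))
      have h2 : (k : ℝ) - s = -(3 / 4 : ℝ) := by rw [hs_def]; ring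
      rw [h2] at h1
      have h3 : g i * Real.exp (-(tripleDeg i * t)) ≤
          B * (s ^ s * t ^ (-s) * (tripleDeg i : ℝ) ^ (-(3 / 4 : ℝ))) := by
        calc _ ≤ B * (tripleDeg i : ℝ) ^ k * Real.exp (-(tripleDeg i * t)) := by
              gcongr
              exact hgB i
          _ = B * ((tripleDeg i : ℝ) ^ k * Real.exp (-(tripleDeg i * t))) := by ring
          _ ≤ _ := by gcongr
      have h4 : -(|mu| / (i.1 : ℝ) * (B * (s ^ s * t ^ (-s) *
          (tripleDeg i : ℝ) ^ (-(3 / 4 : ℝ))))) ≤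
          mu / (i.1 : ℝ) * (g i * Real.exp (-(tripleDeg i * t))) := by
        have h5 : |mu / (i.1 : ℝ) * (g i * Real.exp (-(tripleDeg i * t)))| ≤
            |mu| / (i.1 : ℝ) * (B * (s ^ s * t ^ (-s) *
              (tripleDeg i : ℝ) ^ (-(3 / 4 : ℝ)))) := by
          rw [abs_mul, abs_div, abs_of_pos hj0,
            abs_of_nonneg (mul_nonneg (hg0 i) (Real.exp_pos _).le)]
          gcongr
        linarith [neg_abs_le (mu / (i.1 : ℝ) * (g i * Real.exp (-(tripleDeg i * t))))]
      rw [add_div, add_mul]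
      refine le_trans (le_of_eq ?_) (add_le_add_right h4 _)
      ring
    · simp
  have hfin : lam * ∑ q ∈ Q, g (1, p₀, q) * Real.exp (-((p₀ : ℝ) * q * t)) ≤ ∑' i, f i := by
    have hinj : Function.Injective (fun q : Nat.Primes => ((1, p₀, q) : TripleIdx)) := by
      intro a b h
      simpa using h
    have := hfs.sum_le_tsum (Q.map ⟨_, hinj⟩) (fun i _ => hf0 i)
    refine le_trans (le_of_eq ?_) this
    rw [Finset.sum_map, Finset.mul_sum]
    refine Finset.sum_congr rfl fun q _ => ?_
    simp [hf, tripleDeg]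
  calc _ ≤ ∑' i, f i - ∑' i, D i := by
        rw [hDt]
        have : 0 ≤ B * t ^ (-s) := by positivity
        nlinarith
    _ = ∑' i, (f i - D i) := (hfs.tsum_sub hDs).symm
    _ ≤ _ := (hfs.sub hDs).tsum_le_tsum hpt hsumm

lemma eventually_mul_rpow_neg_le {a b : ℝ} (hab : a < b) (C : ℝ) :
    ∀ᶠ t : ℝ in 𝓝[>] 0, C * t ^ (-a) ≤ t ^ (-b) := by
  have h1 : Tendsto (fun t : ℝ => (t⁻¹) ^ (b - a)) (𝓝[>] 0) atTop :=
    (tendsto_rpow_atTop (sub_pos.2 hab)).comp tendsto_inv_nhdsGT_zero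
  filter_upwards [h1.eventually_ge_atTop C, self_mem_nhdsWithin] with t ht ht0
  have ht0' : (0 : ℝ) < t := ht0
  rw [Real.inv_rpow ht0'.le, ← Real.rpow_neg ht0'.le] at ht
  calc C * t ^ (-a) ≤ t ^ (-(b - a)) * t ^ (-a) := by gcongr
    _ = t ^ (-b) := by rw [← Real.rpow_add ht0']; congr 1; ring

/-- The inclusion of the primes into the naturals. -/
def primesEmbedding : Nat.Primes ↪ ℕ := ⟨fun q => (q : ℕ), Nat.Primes.coe_nat_injective⟩

/-- There are at least `y ^ (399 / 400)` primes up to `y = 1 / t`. -/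
lemma eventually_exists_many_primes : ∀ᶠ t : ℝ in 𝓝[>] 0, ∃ Q : Finset Nat.Primes,
    (∀ q ∈ Q, (q : ℝ) ≤ t⁻¹) ∧ t ^ (-(399 / 400 : ℝ)) ≤ Q.card := by
  have h1 : ∀ᶠ y : ℝ in atTop, Real.log y ≤ (1 / 16) * y ^ (1 / 400 : ℝ) := by
    have := (isLittleO_log_rpow_atTop (r := 1 / 400) (by norm_num)).bound
      (show (0 : ℝ) < 1 / 16 by norm_num)
    filter_upwards [this, eventually_ge_atTop 1] with y hy hy1
    rwa [Real.norm_of_nonneg (Real.log_nonneg hy1), Real.norm_of_nonneg (by positivity)] at hy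
  have h2 : ∀ᶠ y : ℝ in atTop, y ^ (399 / 400 : ℝ) ≤ (Nat.primeCounting ⌊y⌋₊ : ℝ) := by
    filter_upwards [h1, eventually_ge_atTop 4] with y hy hy4
    have hy0 : (0 : ℝ) < y := by linarith
    have hlog : 0 < Real.log y := Real.log_pos (by linarith)
    refine le_trans ?_ (Chebyshev.pi_ge' (by linarith : 1 < y))
    rw [le_div_iff₀ hlog]
    have e1 : y ^ (1 / 400 : ℝ) ≤ y := by
      calc y ^ (1 / 400 : ℝ) ≤ y ^ (1 : ℝ) :=
            Real.rpow_le_rpow_of_exponent_le (by linarith) (by norm_num)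
        _ = y := Real.rpow_one y
    have e2 : Real.log (y + 2) ≤ 2 * Real.log y := by
      calc Real.log (y + 2) ≤ Real.log (y ^ 2) := Real.log_le_log (by linarith) (by nlinarith)
        _ = 2 * Real.log y := by rw [Real.log_pow]; norm_num
    have e3 : y ^ (399 / 400 : ℝ) * Real.log y ≤ (1 / 16) * y := by
      calc y ^ (399 / 400 : ℝ) * Real.log y
          ≤ y ^ (399 / 400 : ℝ) * ((1 / 16) * y ^ (1 / 400 : ℝ)) := by gcongr
        _ = (1 / 16) * (y ^ (399 / 400 : ℝ) * y ^ (1 / 400 : ℝ)) := by ring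
        _ = (1 / 16) * y := by rw [← Real.rpow_add hy0]; norm_num
    have e4 := Real.log_two_gt_d9
    nlinarith
  filter_upwards [tendsto_inv_nhdsGT_zero.eventually h2, self_mem_nhdsWithin] with t ht ht0
  have ht0' : (0 : ℝ) < t := ht0
  refine ⟨(Nat.primesLE ⌊t⁻¹⌋₊).preimage primesEmbedding
    primesEmbedding.injective.injOn, fun q hq => ?_, ?_⟩
  · rw [Finset.mem_preimage, Nat.mem_primesLE] at hq
    exact (Nat.le_floor_iff (by positivity)).1 hq.1
  · classical
    rw [Finset.card_preimage, Finset.filter_true_of_mem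
      (fun q hq => ⟨⟨q, (Nat.mem_primesLE.1 hq).2⟩, rfl⟩), Nat.primesLE_card_eq_primeCounting,
      Real.rpow_neg ht0'.le, ← Real.inv_rpow ht0'.le]
    exact ht

lemma card_pow_three_div_le_sum_sq (Q : Finset Nat.Primes) :
    ((Q.card : ℝ) / 2) ^ 3 ≤ ∑ q ∈ Q, (q : ℝ) ^ 2 := by
  classical
  set L := Q.filter (fun q : Nat.Primes => (q : ℝ) ≤ (Q.card : ℝ) / 2) with hL
  set H := Q.filter (fun q : Nat.Primes => ¬ (q : ℝ) ≤ (Q.card : ℝ) / 2) with hH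
  have h1 : L.card + H.card = Q.card := Finset.card_filter_add_card_filter_not _
  have h2 : L.card ≤ ⌊(Q.card : ℝ) / 2⌋₊ := by
    have : (L.map primesEmbedding).card ≤
        (Finset.Icc 1 ⌊(Q.card : ℝ) / 2⌋₊).card := by
      apply Finset.card_le_card
      intro n hn
      obtain ⟨q, hq, rfl⟩ := Finset.mem_map.1 hn
      rw [hL, Finset.mem_filter] at hq
      rw [Finset.mem_Icc]
      exact ⟨q.2.pos, Nat.le_floor hq.2⟩
    simpa using this
  have h3 : (L.card : ℝ) ≤ (Q.card : ℝ) / 2 :=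
    le_trans (by exact_mod_cast h2) (Nat.floor_le (by positivity))
  have h4 : (Q.card : ℝ) / 2 ≤ H.card := by
    have : (L.card : ℝ) + H.card = Q.card := by exact_mod_cast h1
    linarith
  calc ((Q.card : ℝ) / 2) ^ 3 = ((Q.card : ℝ) / 2) * ((Q.card : ℝ) / 2) ^ 2 := by ring
    _ ≤ H.card * ((Q.card : ℝ) / 2) ^ 2 := by gcongr
    _ = ∑ q ∈ H, ((Q.card : ℝ) / 2) ^ 2 := by simp
    _ ≤ ∑ q ∈ H, (q : ℝ) ^ 2 := by
      refine Finset.sum_le_sum fun q hq => ?_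
      rw [hH, Finset.mem_filter] at hq
      have := hq.2
      push Not at this
      gcongr
    _ ≤ ∑ q ∈ Q, (q : ℝ) ^ 2 :=
      Finset.sum_le_sum_of_subset_of_nonneg (Finset.filter_subset _ _) fun _ _ _ => by positivity

/-- Lower bound for the second moment. -/
lemma eventually_le_second_moment {lam : ℝ} (mu : ℝ) (hlam : 0 < lam) : ∀ᶠ t : ℝ in 𝓝[>] 0,
    t ^ (-(299 / 100 : ℝ)) ≤
    ∑' i, tripleCoeff lam mu i * ((tripleDeg i : ℝ) ^ 2 * Real.exp (-(tripleDeg i * t))) := by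
  obtain ⟨C, hC, h⟩ := exists_le_tsum_weighted mu hlam 2
  set c := lam * Real.exp (-2) / 2 with hc
  have hc0 : 0 < c := by positivity
  filter_upwards [eventually_exists_many_primes, self_mem_nhdsWithin,
    eventually_mul_rpow_neg_le (a := 11 / 4) (b := 299 / 100) (by norm_num) C,
    eventually_mul_rpow_neg_le (a := 299 / 100) (b := 1197 / 400) (by norm_num) (2 / c)]
    with t ⟨Q, hQ, hcard⟩ ht h1 h2
  have ht0 : (0 : ℝ) < t := ht
  obtain ⟨two, htwo⟩ : ∃ p : Nat.Primes, (p : ℕ) = 2 := ⟨⟨2, Nat.prime_two⟩, rfl⟩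
  have htwo' : (two : ℝ) = 2 := by exact_mod_cast htwo
  have h3 := h t ht0 1 zero_le_one (fun i => (tripleDeg i : ℝ) ^ 2) (fun i => by positivity)
    (fun i => by rw [one_mul]) two Q
  refine le_trans ?_ h3
  have h4 : c * t ^ (-(1197 / 400 : ℝ)) ≤ lam * ∑ q ∈ Q,
      (tripleDeg (1, two, q) : ℝ) ^ 2 *
        Real.exp (-((two : ℝ) * q * t)) := by
    have e1 : t ^ (-(1197 / 400 : ℝ)) = (t ^ (-(399 / 400 : ℝ))) ^ 3 := by
      rw [← Real.rpow_natCast, ← Real.rpow_mul ht0.le]; norm_num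
    have e2 : ∀ q ∈ Q, 4 * Real.exp (-2) * (q : ℝ) ^ 2 ≤
        (tripleDeg (1, two, q) : ℝ) ^ 2 *
        Real.exp (-((two : ℝ) * q * t)) := by
      intro q hq
      have hqt : (q : ℝ) * t ≤ 1 := by
        calc (q : ℝ) * t ≤ t⁻¹ * t := by gcongr; exact hQ q hq
          _ = 1 := inv_mul_cancel₀ ht0.ne'
      have e3 : Real.exp (-2) ≤ Real.exp (-((two : ℝ) * q * t)) := by
        apply Real.exp_le_exp.2
        rw [htwo']
        linarith
      calc _ = (2 * (q : ℝ)) ^ 2 * Real.exp (-2) := by ring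
        _ ≤ _ := by
          rw [tripleDeg_one, Nat.cast_mul, htwo']
          rw [htwo'] at e3
          gcongr
    calc c * t ^ (-(1197 / 400 : ℝ)) ≤ c * (Q.card : ℝ) ^ 3 := by rw [e1]; gcongr
      _ = lam * (4 * Real.exp (-2) * ((Q.card : ℝ) / 2) ^ 3) := by rw [hc]; ring
      _ ≤ lam * (4 * Real.exp (-2) * ∑ q ∈ Q, (q : ℝ) ^ 2) := by
        gcongr
        exact card_pow_three_div_le_sum_sq Q
      _ ≤ _ := by
        rw [Finset.mul_sum]
        exact mul_le_mul_of_nonneg_left (Finset.sum_le_sum e2) hlam.le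
  have h5 : 2 * t ^ (-(299 / 100 : ℝ)) ≤ c * t ^ (-(1197 / 400 : ℝ)) := by
    calc _ = c * (2 / c * t ^ (-(299 / 100 : ℝ))) := by field_simp
      _ ≤ _ := by gcongr
  have h6 : ((2 : ℕ) : ℝ) + 3 / 4 = 11 / 4 := by norm_num
  rw [h6]
  linarith

lemma le_one_sub_cos_of_far {x η : ℝ} (hη : 0 ≤ η) (h : ∀ k : ℤ, η ≤ |x - k|) :
    8 * η ^ 2 ≤ 1 - Real.cos (2 * π * x) := by
  have h1 : Real.cos (2 * π * x) = Real.cos (2 * π * (x - round x)) := by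
    rw [← Real.cos_sub_int_mul_two_pi _ (round x)]; congr 1; ring
  have h2 := abs_sub_round x
  have h3 : |2 * π * (x - round x)| ≤ π := by
    rw [abs_mul, abs_of_pos (by positivity)]
    nlinarith [Real.pi_pos]
  have h4 := Real.cos_le_one_sub_mul_cos_sq h3
  have h5 : η ^ 2 ≤ (x - round x) ^ 2 := by
    rw [← sq_abs (x - round x)]
    gcongr
    exact h _
  have h6 : 2 / π ^ 2 * (2 * π * (x - round x)) ^ 2 = 8 * (x - round x) ^ 2 := by
    field_simp; ring
  rw [h1]
  linarith

set_option maxHeartbeats 1000000 in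
/-- Away from `θ = 0`, the modulus of the generating function is much smaller than its value on
the positive real axis. -/
lemma eventually_le_tsum_one_sub_cos {lam : ℝ} (mu : ℝ) (hlam : 0 < lam) :
    ∀ᶠ t : ℝ in 𝓝[>] 0, ∀ θ : ℝ, t ^ (103 / 100 : ℝ) ≤ |θ| → |θ| ≤ π →
    t ^ (-(4 / 5 : ℝ)) ≤ ∑' i, tripleCoeff lam mu i *
      ((1 - Real.cos (tripleDeg i * θ)) * Real.exp (-(tripleDeg i * t))) := by
  classical
  obtain ⟨C, hC, h⟩ := exists_le_tsum_weighted mu hlam 0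
  set c := lam * Real.exp (-3) / 2 with hc
  have hc0 : 0 < c := by positivity
  filter_upwards [eventually_exists_many_primes, self_mem_nhdsWithin,
    eventually_mul_rpow_neg_le (a := 3 / 4) (b := 4 / 5) (by norm_num) (2 * C),
    eventually_mul_rpow_neg_le (a := 4 / 5) (b := 359 / 400) (by norm_num) (2 / c),
    eventually_mul_rpow_neg_le (a := 19 / 20) (b := 399 / 400) (by norm_num) 84,
    eventually_mul_rpow_neg_le (a := 0) (b := 1 / 20) (by norm_num) 16,
    eventually_mul_rpow_neg_le (a := 1 / 20) (b := 399 / 400) (by norm_num) 8,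
    eventually_mul_rpow_neg_le (a := 0) (b := 19 / 20) (by norm_num) 1,
    eventually_mul_rpow_neg_le (a := 103 / 100) (b := 419 / 400) (by norm_num) (16 * π + 1)]
    with t ⟨Q, hQ, hcard⟩ ht h1 h2 h3 h4 h5 h6 h7 θ hθ1 hθ2
  have ht0 : (0 : ℝ) < t := ht
  rw [neg_zero, Real.rpow_zero] at h4 h6
  set η := t ^ (1 / 20 : ℝ) with hη
  have hη0 : 0 < η := by positivity
  set β := θ / (2 * π) with hβ
  have hβθ : ∀ x : ℝ, 2 * π * (x * β) = x * θ := fun x => by rw [hβ]; field_simp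
  set G := Q.filter (fun q : Nat.Primes => ∃ k : ℤ, |(q : ℝ) * β - k| ≤ η) with hG
  set B2 := Q.filter (fun q : Nat.Primes => ∀ k : ℤ, η / 2 ≤ |2 * (q : ℝ) * β - k|) with hB2
  set B3 := Q.filter (fun q : Nat.Primes => ∀ k : ℤ, η / 2 ≤ |3 * (q : ℝ) * β - k|) with hB3
  have hsub : Q ⊆ G ∪ (B2 ∪ B3) := by
    intro q hq
    by_contra hcon
    simp only [hG, hB2, hB3, Finset.mem_union, Finset.mem_filter, hq, true_and, not_or,
      not_exists, not_forall, not_le] at hcon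
    obtain ⟨h1, ⟨k, hk⟩, ⟨l, hl⟩⟩ := hcon
    have := h1 (l - k)
    push_cast at this
    have h2 : (q : ℝ) * β - (l - k) = (3 * (q : ℝ) * β - l) - (2 * (q : ℝ) * β - k) := by ring
    rw [h2] at this
    linarith [abs_sub (3 * (q : ℝ) * β - l) (2 * (q : ℝ) * β - k)]
  have hcards : (Q.card : ℝ) ≤ G.card + (B2.card + B3.card) := by
    have := (Finset.card_le_card hsub).trans ((Finset.card_union_le _ _).trans
      (Nat.add_le_add_left (Finset.card_union_le _ _) _))
    exact_mod_cast this
  have hGhalf : (G.card : ℝ) < Q.card / 2 := by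
    by_contra! hcon
    have hGc : t ^ (-(399 / 400 : ℝ)) / 2 ≤ G.card := by linarith
    set N := ⌊t ^ (-(1 / 20 : ℝ)) / 8⌋₊ with hN
    have hN1 : (N : ℝ) ≤ t ^ (-(1 / 20 : ℝ)) / 8 := Nat.floor_le (by positivity)
    have hN2 : t ^ (-(1 / 20 : ℝ)) / 16 ≤ N := by
      have := Nat.lt_floor_add_one (t ^ (-(1 / 20 : ℝ)) / 8)
      linarith
    have hNpos : 0 < N := by
      have : (0 : ℝ) < N := lt_of_lt_of_le (by positivity) hN2
      exact_mod_cast this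
    have hηN : η * t ^ (-(1 / 20 : ℝ)) = 1 := by
      rw [hη, ← Real.rpow_add ht0]; norm_num
    have e1 : η * t⁻¹ = t ^ (-(19 / 20 : ℝ)) := by
      rw [hη, ← Real.rpow_neg_one, ← Real.rpow_add ht0]; norm_num
    have e2 : 2 * t⁻¹ / N ≤ 32 * t ^ (-(19 / 20 : ℝ)) := by
      rw [div_le_iff₀ (by exact_mod_cast hNpos)]
      calc 2 * t⁻¹ = 2 * (t ^ (-(19 / 20 : ℝ)) * t ^ (-(1 / 20 : ℝ))) := by
            rw [← Real.rpow_add ht0, ← Real.rpow_neg_one]; norm_num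
        _ = 32 * t ^ (-(19 / 20 : ℝ)) * (t ^ (-(1 / 20 : ℝ)) / 16) := by ring
        _ ≤ _ := by gcongr
    obtain ⟨k, hk⟩ := exists_int_near_of_primes_near
      (G.map primesEmbedding)
      (by
        intro n hn
        obtain ⟨q, hq, rfl⟩ := Finset.mem_map.1 hn
        exact q.2) t⁻¹ η β N
      (by
        intro n hn
        obtain ⟨q, hq, rfl⟩ := Finset.mem_map.1 hn
        exact hQ q (Finset.mem_filter.1 hq).1) (by positivity) hη0 hNpos
      (by
        calc 4 * η * N ≤ 4 * η * (t ^ (-(1 / 20 : ℝ)) / 8) := by gcongr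
          _ = (η * t ^ (-(1 / 20 : ℝ))) / 2 := by ring
          _ < 1 := by rw [hηN]; norm_num)
      (by
        intro n hn
        obtain ⟨q, hq, rfl⟩ := Finset.mem_map.1 hn
        exact (Finset.mem_filter.1 hq).2)
      (by
        rw [Finset.card_map]
        have : 8 * η * t⁻¹ = 8 * t ^ (-(19 / 20 : ℝ)) := by rw [mul_assoc, e1]
        linarith)
      (by
        rw [Finset.card_map]
        have : (N : ℝ) + 1 < G.card := by linarith
        exact_mod_cast this)
    rw [Finset.card_map] at hk
    have hGc' : t ^ (-(399 / 400 : ℝ)) / 4 ≤ (G.card : ℝ) - 1 := by linarith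
    have hk0 : k = 0 := by
      by_contra hk0
      have a1 : (1 : ℝ) ≤ |(k : ℝ)| := by
        exact_mod_cast Int.one_le_abs hk0
      have a2 : |β| ≤ 1 / 2 := by
        rw [hβ, abs_div, abs_of_pos (by positivity : 0 < 2 * π), div_le_iff₀ (by positivity)]
        linarith
      have a3 : 1 / 2 ≤ |β - k| := by
        have := abs_sub_abs_le_abs_sub (k : ℝ) β
        rw [abs_sub_comm] at this
        linarith
      have a4 : η ≤ 1 := by
        have : (1 : ℝ) ≤ t ^ (-(1 / 20 : ℝ)) := by linarith
        nlinarith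
      nlinarith
    rw [hk0, Int.cast_zero, sub_zero] at hk
    have b1 : |β| * (t ^ (-(399 / 400 : ℝ)) / 4) ≤ 2 * η :=
      le_trans (by gcongr) hk
    have b2 : |θ| = 2 * π * |β| := by
      rw [hβ, abs_div, abs_of_pos (by positivity : 0 < 2 * π)]; field_simp
    have b3 : |θ| * t ^ (-(399 / 400 : ℝ)) ≤ 16 * π * η := by
      rw [b2]
      calc _ = 8 * π * (|β| * (t ^ (-(399 / 400 : ℝ)) / 4)) := by ring
        _ ≤ 8 * π * (2 * η) := by gcongr
        _ = _ := by ring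
    have b4 : t ^ (103 / 100 : ℝ) * t ^ (-(399 / 400 : ℝ)) ≤ 16 * π * η :=
      le_trans (by gcongr) b3
    have b5 : t ^ (-(419 / 400 : ℝ)) ≤ 16 * π * t ^ (-(103 / 100 : ℝ)) := by
      have c1 : t ^ (-(419 / 400 : ℝ)) =
          (t ^ (103 / 100 : ℝ) * t ^ (-(399 / 400 : ℝ))) * t ^ (-(108 / 100 : ℝ)) := by
        rw [← Real.rpow_add ht0, ← Real.rpow_add ht0]; norm_num
      have c2 : t ^ (-(103 / 100 : ℝ)) = η * t ^ (-(108 / 100 : ℝ)) := by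
        rw [hη, ← Real.rpow_add ht0]; norm_num
      rw [c1, c2, ← mul_assoc]
      gcongr
    have b6 : 0 < t ^ (-(103 / 100 : ℝ)) := by positivity
    linarith
  have hsq : η ^ 2 * t ^ (-(399 / 400 : ℝ)) = t ^ (-(359 / 400 : ℝ)) := by
    rw [hη, ← Real.rpow_natCast, ← Real.rpow_mul ht0.le, ← Real.rpow_add ht0]; norm_num
  have part : ∀ (p₀ : Nat.Primes) (B : Finset Nat.Primes), (p₀ : ℕ) ≤ 3 → B ⊆ Q →
      (∀ q ∈ B, ∀ k : ℤ, η / 2 ≤ |(p₀ : ℝ) * (q : ℝ) * β - k|) →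
      lam * (B.card * (2 * η ^ 2 * Real.exp (-3))) - C * 2 * t ^ (-(3 / 4 : ℝ)) ≤
      ∑' i, tripleCoeff lam mu i *
        ((1 - Real.cos (tripleDeg i * θ)) * Real.exp (-(tripleDeg i * t))) := by
    intro p₀ B hp₀ hB hfar
    have := h t ht0 2 zero_le_two (fun i => 1 - Real.cos (tripleDeg i * θ))
      (fun i => by linarith [Real.cos_le_one (tripleDeg i * θ)])
      (fun i => by rw [pow_zero]; linarith [Real.neg_one_le_cos (tripleDeg i * θ)]) p₀ B
    rw [Nat.cast_zero, zero_add] at this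
    refine le_trans ?_ this
    gcongr
    rw [← nsmul_eq_mul, ← Finset.sum_const]
    refine Finset.sum_le_sum fun q hq => ?_
    have hp₀' : (p₀ : ℝ) ≤ 3 := by exact_mod_cast hp₀
    have hqt : (q : ℝ) * t ≤ 1 := by
      calc (q : ℝ) * t ≤ t⁻¹ * t := by gcongr; exact hQ q (hB hq)
        _ = 1 := inv_mul_cancel₀ ht0.ne'
    have f1 : Real.exp (-3) ≤ Real.exp (-((p₀ : ℝ) * q * t)) := by
      apply Real.exp_le_exp.2
      have : (p₀ : ℝ) * (q * t) ≤ 3 * 1 := by gcongr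
      linarith
    have f2 := le_one_sub_cos_of_far (by positivity) (hfar q hq)
    have f3 : 2 * π * ((p₀ : ℝ) * (q : ℝ) * β) = (tripleDeg (1, p₀, q) : ℝ) * θ := by
      rw [hβθ, tripleDeg_one, Nat.cast_mul]
    rw [f3] at f2
    have f4 : 2 * η ^ 2 ≤ 1 - Real.cos ((tripleDeg (1, p₀, q) : ℝ) * θ) := by linarith
    have : 0 ≤ 2 * η ^ 2 := by positivity
    exact mul_le_mul f4 f1 (Real.exp_pos _).le (by linarith)
  obtain ⟨two, htwo⟩ : ∃ p : Nat.Primes, (p : ℕ) = 2 := ⟨⟨2, Nat.prime_two⟩, rfl⟩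
  have htwo' : (two : ℝ) = 2 := by exact_mod_cast htwo
  obtain ⟨three, hthree⟩ : ∃ p : Nat.Primes, (p : ℕ) = 3 := ⟨⟨3, Nat.prime_three⟩, rfl⟩
  have hthree' : (three : ℝ) = 3 := by exact_mod_cast hthree
  have p2 := part two B2 (by omega) (Finset.filter_subset _ _)
    (fun q hq => by
      rw [htwo']
      exact (Finset.mem_filter.1 hq).2)
  have p3 := part three B3 (by omega) (Finset.filter_subset _ _)
    (fun q hq => by
      rw [hthree']
      exact (Finset.mem_filter.1 hq).2)
  have hBc : t ^ (-(399 / 400 : ℝ)) / 2 ≤ B2.card + B3.card := by linarith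
  have h8 : c * t ^ (-(359 / 400 : ℝ)) ≤
      lam * ((B2.card + B3.card) * (η ^ 2 * Real.exp (-3))) := by
    rw [← hsq]
    calc _ = lam * (t ^ (-(399 / 400 : ℝ)) / 2 * (η ^ 2 * Real.exp (-3))) := by rw [hc]; ring
      _ ≤ _ := by gcongr
  have h9 : 2 * t ^ (-(4 / 5 : ℝ)) ≤ c * t ^ (-(359 / 400 : ℝ)) := by
    calc _ = c * (2 / c * t ^ (-(4 / 5 : ℝ))) := by field_simp
      _ ≤ _ := by gcongr
  linarith

lemma pow_eq_exp_neg {r t : ℝ} (h : r = Real.exp (-t)) (m : ℕ) :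
    r ^ m = Real.exp (-(m * t)) := by
  rw [h, ← Real.exp_nat_mul]; congr 1; ring

lemma summable_abs_moment (lam mu : ℝ) (k : ℕ) {t : ℝ} (ht : 0 < t) :
    Summable fun i => |tripleCoeff lam mu i| *
      ((tripleDeg i : ℝ) ^ k * Real.exp (-(tripleDeg i * t))) := by
  obtain ⟨C, -, h⟩ := exists_tsum_abs_moment_le lam mu k
  exact (h t ht).1

lemma summable_moment (lam mu : ℝ) (k : ℕ) {t : ℝ} (ht : 0 < t) :
    Summable fun i => tripleCoeff lam mu i *
      ((tripleDeg i : ℝ) ^ k * Real.exp (-(tripleDeg i * t))) := by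
  refine Summable.of_norm ((summable_abs_moment lam mu k ht).congr fun i => ?_)
  rw [norm_mul, Real.norm_eq_abs, Real.norm_of_nonneg (by positivity)]

lemma summable_tripleCoeff_mul_pow {𝕜 : Type*} [RCLike 𝕜] (lam mu : ℝ) {z : 𝕜} {t : ℝ}
    (ht : 0 < t) (hz : ‖z‖ = Real.exp (-t)) :
    Summable fun i => (tripleCoeff lam mu i : 𝕜) * z ^ tripleDeg i := by
  refine Summable.of_norm ((summable_abs_moment lam mu 0 ht).congr fun i => ?_)
  rw [norm_mul, norm_pow, RCLike.norm_ofReal, pow_eq_exp_neg hz, pow_zero, one_mul]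

lemma tripleCoeff_eq (lam mu : ℝ) (i : TripleIdx) :
    tripleCoeff lam mu i = lam * tripleCoeff 1 0 i + mu * tripleCoeff 0 1 i := by
  simp only [tripleCoeff]
  split_ifs <;> ring

/-- `λ Φ_{P₂} + μ Φ_{P²}` as a single series. -/
lemma phi_eq_tsum {𝕜 : Type*} [RCLike 𝕜] (lam mu : ℝ) {z : 𝕜} {t : ℝ}
    (ht : 0 < t) (hz : ‖z‖ = Real.exp (-t)) :
    (lam : 𝕜) * (∑' (j : ℕ+) (p : Nat.Primes) (q : Nat.Primes),
      (1 / (j : 𝕜)) * z ^ ((p : ℕ) * (q : ℕ) * (j : ℕ))) +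
    (mu : 𝕜) * (∑' (j : ℕ+) (p : Nat.Primes), (1 / (j : 𝕜)) * z ^ ((p : ℕ) ^ 2 * (j : ℕ))) =
    ∑' i, (tripleCoeff lam mu i : 𝕜) * z ^ tripleDeg i := by
  have s1 := summable_tripleCoeff_mul_pow 1 0 ht hz
  have s2 := summable_tripleCoeff_mul_pow 0 1 ht hz
  have e1 : ∑' i, (tripleCoeff 1 0 i : 𝕜) * z ^ tripleDeg i =
      ∑' (j : ℕ+) (p : Nat.Primes) (q : Nat.Primes),
      (1 / (j : 𝕜)) * z ^ ((p : ℕ) * (q : ℕ) * (j : ℕ)) := by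
    rw [s1.tsum_prod]
    refine tsum_congr fun j => ?_
    rw [(s1.prod_factor j).tsum_prod]
    refine tsum_congr fun p => tsum_congr fun q => ?_
    simp [tripleCoeff, tripleDeg]
  have e2 : ∑' i, (tripleCoeff 0 1 i : 𝕜) * z ^ tripleDeg i =
      ∑' (j : ℕ+) (p : Nat.Primes), (1 / (j : 𝕜)) * z ^ ((p : ℕ) ^ 2 * (j : ℕ)) := by
    rw [s2.tsum_prod]
    refine tsum_congr fun j => ?_
    rw [(s2.prod_factor j).tsum_prod]
    refine tsum_congr fun p => ?_
    rw [tsum_eq_single p]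
    · simp [tripleCoeff, tripleDeg, sq]
    · intro q hq
      simp [tripleCoeff, hq.symm]
  rw [← e1, ← e2, ← tsum_mul_left, ← tsum_mul_left,
    ← (s1.mul_left _).tsum_add (s2.mul_left _)]
  refine tsum_congr fun i => ?_
  rw [tripleCoeff_eq lam mu]
  push_cast
  ring

/-- The series `∑ c(i) m(i) ^ k r ^ m(i)`. -/
def momentSum (lam mu : ℝ) (k : ℕ) (r : ℝ) : ℝ :=
  ∑' i, tripleCoeff lam mu i * ((tripleDeg i : ℝ) ^ k * r ^ tripleDeg i)

lemma momentSum_exp_neg (lam mu : ℝ) (k : ℕ) (t : ℝ) :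
    momentSum lam mu k (Real.exp (-t)) = ∑' i, tripleCoeff lam mu i *
      ((tripleDeg i : ℝ) ^ k * Real.exp (-(tripleDeg i * t))) :=
  tsum_congr fun i => by rw [pow_eq_exp_neg rfl]

lemma phi_eq_momentSum (lam mu : ℝ) {r : ℝ} (hr : r ∈ Set.Ioo (0 : ℝ) 1) :
    lam * PhiP2 r + mu * PhiPsq r = momentSum lam mu 0 r := by
  have h := phi_eq_tsum lam mu (z := r) (t := -Real.log r)
    (by linarith [Real.log_neg hr.1 hr.2])
    (by rw [neg_neg, Real.exp_log hr.1, Real.norm_of_nonneg hr.1.le])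
  simpa [PhiP2, PhiPsq, momentSum] using h

lemma phiC_eq_tsum (lam mu : ℝ) {z : ℂ} {t : ℝ} (ht : 0 < t) (hz : ‖z‖ = Real.exp (-t)) :
    (lam : ℂ) * PhiP2C z + (mu : ℂ) * PhiPsqC z =
    ∑' i, (tripleCoeff lam mu i : ℂ) * z ^ tripleDeg i :=
  phi_eq_tsum lam mu ht hz

lemma hasDerivAt_momentSum (lam mu : ℝ) (k : ℕ) {r : ℝ} (hr : r ∈ Set.Ioo (0 : ℝ) 1) :
    HasDerivAt (momentSum lam mu k) (momentSum lam mu (k + 1) r / r) r := by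
  obtain ⟨s, hs1, hs2⟩ := exists_between hr.2
  have hs0 : 0 < s := hr.1.trans hs1
  have hlog := Real.log_neg hs0 hs2
  have hsexp : s = Real.exp (-(-Real.log s)) := by rw [neg_neg, Real.exp_log hs0]
  have hlogr := Real.log_neg hr.1 hr.2
  have hrexp : r = Real.exp (-(-Real.log r)) := by rw [neg_neg, Real.exp_log hr.1]
  have key := hasDerivAt_tsum_of_isPreconnected
    (g := fun i (y : ℝ) => tripleCoeff lam mu i * ((tripleDeg i : ℝ) ^ k * y ^ tripleDeg i))
    (g' := fun i (y : ℝ) => tripleCoeff lam mu i *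
      ((tripleDeg i : ℝ) ^ k * (tripleDeg i * y ^ (tripleDeg i - 1))))
    (u := fun i => |tripleCoeff lam mu i| * ((tripleDeg i : ℝ) ^ (k + 1) * s ^ tripleDeg i) / s)
    (t := Set.Ioo 0 s) (y₀ := r) (y := r)
    (by
      refine Summable.div_const ?_ s
      refine (summable_abs_moment lam mu (k + 1)
        (t := -Real.log s) (by linarith)).congr fun i => ?_
      rw [pow_eq_exp_neg hsexp])
    isOpen_Ioo isPreconnected_Ioo
    (fun i y _ => ((hasDerivAt_pow (tripleDeg i) y).const_mul _).const_mul _)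
    (fun i y hy => by
      have e : s ^ tripleDeg i = s ^ (tripleDeg i - 1) * s := by
        rw [← pow_succ, Nat.sub_add_cancel (tripleDeg_pos i)]
      have hy0 := hy.1.le
      rw [norm_mul, Real.norm_eq_abs, Real.norm_of_nonneg (by positivity), e]
      calc _ ≤ |tripleCoeff lam mu i| *
            ((tripleDeg i : ℝ) ^ k * (tripleDeg i * s ^ (tripleDeg i - 1))) := by
            gcongr
            exact hy.2.le
        _ = _ := by rw [pow_succ (tripleDeg i : ℝ)]; field_simp)
    ⟨hr.1, hs1⟩
    (by
      refine (summable_moment lam mu k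
        (t := -Real.log r) (by linarith)).congr fun i => ?_
      rw [pow_eq_exp_neg hrexp])
    ⟨hr.1, hs1⟩
  have hval : momentSum lam mu (k + 1) r / r = ∑' i, tripleCoeff lam mu i *
      ((tripleDeg i : ℝ) ^ k * (tripleDeg i * r ^ (tripleDeg i - 1))) := by
    rw [momentSum, ← tsum_div_const]
    refine tsum_congr fun i => ?_
    have e : r ^ tripleDeg i = r ^ (tripleDeg i - 1) * r := by
      rw [← pow_succ, Nat.sub_add_cancel (tripleDeg_pos i)]
    have := hr.1.ne'
    rw [e, pow_succ (tripleDeg i : ℝ)]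
    field_simp
  rw [hval]
  exact key

lemma mul_deriv_phi (lam mu : ℝ) {r : ℝ} (hr : r ∈ Set.Ioo (0 : ℝ) 1) :
    r * deriv (fun r => lam * PhiP2 r + mu * PhiPsq r) r = momentSum lam mu 1 r := by
  have h : (fun r => lam * PhiP2 r + mu * PhiPsq r) =ᶠ[𝓝 r] momentSum lam mu 0 := by
    filter_upwards [isOpen_Ioo.mem_nhds hr] with s hs using phi_eq_momentSum lam mu hs
  rw [h.deriv_eq, (hasDerivAt_momentSum lam mu 0 hr).deriv, mul_div_cancel₀ _ hr.1.ne']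

lemma dop_dop_phi (lam mu : ℝ) {r : ℝ} (hr : r ∈ Set.Ioo (0 : ℝ) 1) :
    (Dop^[2] (fun r => lam * PhiP2 r + mu * PhiPsq r)) r = momentSum lam mu 2 r := by
  have h : Dop (fun r => lam * PhiP2 r + mu * PhiPsq r) =ᶠ[𝓝 r] momentSum lam mu 1 := by
    filter_upwards [isOpen_Ioo.mem_nhds hr] with s hs using mul_deriv_phi lam mu hs
  change r * deriv (Dop fun r => lam * PhiP2 r + mu * PhiPsq r) r = _
  rw [h.deriv_eq, (hasDerivAt_momentSum lam mu 1 hr).deriv, mul_div_cancel₀ _ hr.1.ne']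

lemma norm_exp_I_sub_taylor_le (x : ℝ) :
    ‖Complex.exp (x * Complex.I) - 1 - x * Complex.I + (x : ℂ) ^ 2 / 2‖ ≤ 4 * |x| ^ 3 := by
  have hn : ‖(x : ℂ) * Complex.I‖ = |x| := by simp
  rcases le_or_gt |x| 1 with h | h
  · have h1 := Complex.norm_exp_sub_sum_le_norm_mul_exp ((x : ℂ) * Complex.I) 3
    rw [hn] at h1
    have h2 : ∑ m ∈ Finset.range 3, ((x : ℂ) * Complex.I) ^ m / (m.factorial : ℂ) =
        1 + x * Complex.I - (x : ℂ) ^ 2 / 2 := by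
      simp [Finset.sum_range_succ, mul_pow]
      ring
    rw [h2] at h1
    have h3 : Real.exp |x| ≤ 4 := by
      have := Real.exp_le_exp.2 h
      linarith [Real.exp_one_lt_d9]
    calc _ = ‖Complex.exp (x * Complex.I) - (1 + x * Complex.I - (x : ℂ) ^ 2 / 2)‖ := by
          congr 1; ring
      _ ≤ |x| ^ 3 * Real.exp |x| := h1
      _ ≤ |x| ^ 3 * 4 := by gcongr
      _ = _ := by ring
  · have h4 : ‖(x : ℂ) ^ 2 / 2‖ = |x| ^ 2 / 2 := by simp
    have h5 := norm_add_le (Complex.exp (x * Complex.I) - 1 - x * Complex.I) ((x : ℂ) ^ 2 / 2)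
    have h6 := norm_sub_le (Complex.exp (x * Complex.I) - 1) (x * Complex.I)
    have h7 := norm_sub_le (Complex.exp (x * Complex.I)) 1
    calc _ ≤ ‖Complex.exp (x * Complex.I)‖ + ‖(1 : ℂ)‖ + ‖(x : ℂ) * Complex.I‖ +
          ‖(x : ℂ) ^ 2 / 2‖ := by linarith
      _ = 1 + 1 + |x| + |x| ^ 2 / 2 := by
        rw [Complex.norm_exp_ofReal_mul_I, hn, h4, norm_one]
      _ ≤ 4 * |x| ^ 3 := by
        have e1 : |x| ≤ |x| ^ 2 := by nlinarith
        have e2 : |x| ^ 2 ≤ |x| ^ 3 := by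
          rw [pow_succ |x| 2]
          nlinarith [sq_nonneg |x|]
        nlinarith

lemma norm_exp_sub_exp_ofReal_le (w : ℂ) (a R : ℝ) (h : ‖w - a‖ ≤ R) :
    ‖Complex.exp w - Complex.exp a‖ ≤ Real.exp a * (R * Real.exp R) := by
  have h1 := Complex.norm_exp_sub_sum_le_norm_mul_exp (w - a) 1
  simp only [Finset.range_one, Finset.sum_singleton, pow_zero, Nat.factorial_zero, Nat.cast_one,
    div_one, pow_one] at h1
  have h2 : Complex.exp w - Complex.exp a = Complex.exp a * (Complex.exp (w - a) - 1) := by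
    rw [mul_sub, ← Complex.exp_add, mul_one]; congr 2; ring
  have h0 : 0 ≤ R := (norm_nonneg _).trans h
  rw [h2, norm_mul, Complex.norm_exp, Complex.ofReal_re]
  gcongr
  exact h1.trans (by gcongr)

lemma cube_mul_exp_neg_le (x : ℝ) : x ^ 3 * Real.exp (-(x ^ 2 / 8)) ≤ 16 := by
  have h := Real.quadratic_le_exp_of_nonneg (show 0 ≤ x ^ 2 / 8 by positivity)
  rw [Real.exp_neg, ← div_eq_mul_inv, div_le_iff₀ (Real.exp_pos _)]
  have : 0 ≤ (x ^ 2 - 4 * x) ^ 2 := sq_nonneg _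
  nlinarith [sq_nonneg x]

/-- Quantitative Laplace method on `[-π, π]`. -/
lemma norm_integral_exp_sub_gaussian_le (w : ℝ → ℂ) (hw : Continuous w) {σ B δ M : ℝ}
    (hσ : 0 < σ) (hB : 0 ≤ B) (hδ : 0 < δ) (hδπ : δ ≤ π) (hBδ : B * δ ≤ σ ^ 2 / 4)
    (h1 : ∀ θ, |θ| ≤ δ → ‖w θ + ((σ ^ 2 * θ ^ 2 / 2 : ℝ) : ℂ)‖ ≤ B * |θ| ^ 3)
    (h2 : ∀ θ, δ ≤ |θ| → |θ| ≤ π → (w θ).re ≤ -M) :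
    ‖(∫ θ in (-π)..π, Complex.exp (w θ)) - ((√(2 * π) / σ : ℝ) : ℂ)‖ ≤
      (B + (δ ^ 3)⁻¹) * (16 / σ ^ 3) * (√(8 * π) / σ) + 2 * π * Real.exp (-M) := by
  have hpi := Real.pi_pos
  set g : ℝ → ℂ := fun θ => ((Real.exp (-(σ ^ 2 / 2) * θ ^ 2) : ℝ) : ℂ) with hg
  set f : ℝ → ℂ := (Set.Ioc (-π) π).indicator (fun θ => Complex.exp (w θ)) with hf
  set K := (B + (δ ^ 3)⁻¹) * (16 / σ ^ 3) with hK
  set b : ℝ → ℝ := fun θ => K * Real.exp (-(σ ^ 2 / 8) * θ ^ 2) +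
    (Set.Ioc (-π) π).indicator (fun _ => Real.exp (-M)) θ with hb
  have hgint : MeasureTheory.Integrable g :=
    (integrable_exp_neg_mul_sq (by positivity : 0 < σ ^ 2 / 2)).ofReal
  have hfint : MeasureTheory.Integrable f := by
    rw [hf, MeasureTheory.integrable_indicator_iff measurableSet_Ioc]
    exact (hw.cexp.integrableOn_Icc).mono_set Set.Ioc_subset_Icc_self
  have hcint : MeasureTheory.Integrable
      ((Set.Ioc (-π) π).indicator (fun _ : ℝ => Real.exp (-M))) := by
    rw [MeasureTheory.integrable_indicator_iff measurableSet_Ioc]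
    exact (continuous_const.integrableOn_Icc).mono_set Set.Ioc_subset_Icc_self
  have heint : MeasureTheory.Integrable (fun θ : ℝ => K * Real.exp (-(σ ^ 2 / 8) * θ ^ 2)) :=
    (integrable_exp_neg_mul_sq (by positivity : 0 < σ ^ 2 / 8)).const_mul _
  have hfi : ∫ θ, f θ = ∫ θ in (-π)..π, Complex.exp (w θ) := by
    rw [hf, MeasureTheory.integral_indicator measurableSet_Ioc,
      intervalIntegral.integral_of_le (by linarith)]
  have hgi : ∫ θ, g θ = ((√(2 * π) / σ : ℝ) : ℂ) := by
    simp only [hg]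
    rw [integral_complex_ofReal, integral_gaussian]
    congr 1
    have : π / (σ ^ 2 / 2) = 2 * π / σ ^ 2 := by field_simp
    rw [this, Real.sqrt_div (by positivity), Real.sqrt_sq hσ.le]
  have hbi : ∫ θ, b θ = K * (√(8 * π) / σ) + 2 * π * Real.exp (-M) := by
    rw [hb, MeasureTheory.integral_add heint hcint, MeasureTheory.integral_const_mul,
      integral_gaussian, MeasureTheory.integral_indicator measurableSet_Ioc]
    have : π / (σ ^ 2 / 8) = 8 * π / σ ^ 2 := by field_simp
    rw [this, Real.sqrt_div (by positivity), Real.sqrt_sq hσ.le]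
    congr 1
    rw [MeasureTheory.setIntegral_const, MeasureTheory.measureReal_def, Real.volume_Ioc,
      ENNReal.toReal_ofReal (by linarith), smul_eq_mul]
    ring
  rw [← hfi, ← hgi, ← MeasureTheory.integral_sub hfint hgint, ← hbi]
  refine MeasureTheory.norm_integral_le_of_norm_le (heint.add hcint) (.of_forall fun θ => ?_)
  have hK0 : 0 ≤ K := by positivity
  have key : (B + (δ ^ 3)⁻¹) * |θ| ^ 3 * Real.exp (-(σ ^ 2 / 4) * θ ^ 2) ≤
      K * Real.exp (-(σ ^ 2 / 8) * θ ^ 2) := by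
    have e1 := cube_mul_exp_neg_le (σ * |θ|)
    have e2 : Real.exp (-(σ ^ 2 / 4) * θ ^ 2) =
        Real.exp (-((σ * |θ|) ^ 2 / 8)) * Real.exp (-(σ ^ 2 / 8) * θ ^ 2) := by
      rw [← Real.exp_add, mul_pow, sq_abs]; congr 1; ring
    rw [e2, hK]
    have e3 : |θ| ^ 3 * Real.exp (-((σ * |θ|) ^ 2 / 8)) ≤ 16 / σ ^ 3 := by
      rw [le_div_iff₀ (by positivity)]
      calc _ = (σ * |θ|) ^ 3 * Real.exp (-((σ * |θ|) ^ 2 / 8)) := by ring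
        _ ≤ 16 := e1
    calc _ = (B + (δ ^ 3)⁻¹) * (|θ| ^ 3 * Real.exp (-((σ * |θ|) ^ 2 / 8))) *
          Real.exp (-(σ ^ 2 / 8) * θ ^ 2) := by ring
      _ ≤ _ := by gcongr
  have hgn : ‖g θ‖ = Real.exp (-(σ ^ 2 / 2) * θ ^ 2) := by
    rw [hg, Complex.norm_real, Real.norm_of_nonneg (Real.exp_pos _).le]
  have hfar : δ ≤ |θ| → ‖g θ‖ ≤ K * Real.exp (-(σ ^ 2 / 8) * θ ^ 2) := by
    intro hθ
    refine le_trans ?_ key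
    rw [hgn]
    have e1 : 1 ≤ (δ ^ 3)⁻¹ * |θ| ^ 3 := by
      rw [inv_mul_eq_div, one_le_div (by positivity)]
      gcongr
    have e2 : Real.exp (-(σ ^ 2 / 2) * θ ^ 2) ≤ Real.exp (-(σ ^ 2 / 4) * θ ^ 2) := by
      apply Real.exp_le_exp.2
      nlinarith [mul_nonneg (sq_nonneg σ) (sq_nonneg θ)]
    have e3 : 1 ≤ (B + (δ ^ 3)⁻¹) * |θ| ^ 3 := by
      have : 0 ≤ B * |θ| ^ 3 := by positivity
      linarith
    calc _ ≤ 1 * Real.exp (-(σ ^ 2 / 4) * θ ^ 2) := by rw [one_mul]; exact e2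
      _ ≤ _ := by gcongr
  rw [hb]
  by_cases hmem : θ ∈ Set.Ioc (-π) π
  · simp only [hf, Set.indicator_of_mem hmem]
    rcases le_or_gt |θ| δ with hθ | hθ
    · have e1 : ‖w θ - ((-(σ ^ 2 / 2) * θ ^ 2 : ℝ) : ℂ)‖ ≤ B * |θ| ^ 3 := by
        convert h1 θ hθ using 2
        push_cast
        ring
      have e2 := norm_exp_sub_exp_ofReal_le _ _ _ e1
      have e3 : Real.exp (B * |θ| ^ 3) ≤ Real.exp (σ ^ 2 / 4 * θ ^ 2) := by
        apply Real.exp_le_exp.2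
        calc B * |θ| ^ 3 = B * |θ| * |θ| ^ 2 := by ring
          _ ≤ B * δ * |θ| ^ 2 := by gcongr
          _ ≤ σ ^ 2 / 4 * |θ| ^ 2 := by gcongr
          _ = _ := by rw [sq_abs]
      have e4 : Real.exp (-(σ ^ 2 / 2) * θ ^ 2) * (B * |θ| ^ 3 * Real.exp (B * |θ| ^ 3)) ≤
          (B + (δ ^ 3)⁻¹) * |θ| ^ 3 * Real.exp (-(σ ^ 2 / 4) * θ ^ 2) := by
        calc _ ≤ Real.exp (-(σ ^ 2 / 2) * θ ^ 2) *
              (B * |θ| ^ 3 * Real.exp (σ ^ 2 / 4 * θ ^ 2)) := by gcongr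
          _ = B * |θ| ^ 3 * (Real.exp (-(σ ^ 2 / 2) * θ ^ 2) *
              Real.exp (σ ^ 2 / 4 * θ ^ 2)) := by ring
          _ = B * |θ| ^ 3 * Real.exp (-(σ ^ 2 / 4) * θ ^ 2) := by
            rw [← Real.exp_add]; congr 2; ring
          _ ≤ _ := by
            gcongr
            have : 0 < (δ ^ 3)⁻¹ := by positivity
            linarith
      have e5 : g θ = Complex.exp ((-(σ ^ 2 / 2) * θ ^ 2 : ℝ) : ℂ) := by
        rw [hg]; simp only [Complex.ofReal_exp]
      rw [e5]
      have := Real.exp_pos (-M)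
      linarith
    · have hθπ : |θ| ≤ π := abs_le.2 ⟨hmem.1.le, hmem.2⟩
      have e1 : ‖Complex.exp (w θ)‖ ≤ Real.exp (-M) := by
        rw [Complex.norm_exp]
        exact Real.exp_le_exp.2 (h2 θ hθ.le hθπ)
      have := hfar hθ.le
      linarith [norm_sub_le (Complex.exp (w θ)) (g θ)]
  · simp only [hf, Set.indicator_of_notMem hmem, zero_sub, norm_neg, add_zero]
    apply hfar
    refine hδπ.trans ?_
    by_contra! hcon
    exact hmem ⟨(abs_lt.1 hcon).1, (abs_lt.1 hcon).2.le⟩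

lemma integral_exp_int_mul_I (k : ℤ) :
    ∫ θ in (-π)..π, Complex.exp (k * Complex.I * θ) = if k = 0 then (2 * π : ℂ) else 0 := by
  split_ifs with hk
  · subst hk
    simp
    ring
  · have hc : (k : ℂ) * Complex.I ≠ 0 :=
      mul_ne_zero (by exact_mod_cast hk) Complex.I_ne_zero
    rw [integral_exp_mul_complex hc, div_eq_zero_iff, sub_eq_zero]
    left
    rw [Complex.exp_eq_exp_iff_exists_int]
    exact ⟨k, by push_cast; ring⟩

/-- Cauchy's coefficient formula for a power series converging on the unit disc. -/
lemma integral_mul_exp_eq_coeff {p : ℕ → ℝ} {F : ℂ → ℂ}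
    (h : ∀ z : ℂ, ‖z‖ < 1 → HasSum (fun n : ℕ => (p n : ℂ) * z ^ n) (F z))
    {r : ℝ} (hr0 : 0 ≤ r) (hr1 : r < 1) (n : ℕ) :
    ∫ θ in (-π)..π, F (r * Complex.exp (θ * Complex.I)) * Complex.exp (-(n * θ * Complex.I)) =
      2 * π * (p n * r ^ n) := by
  have hnorm : ∀ θ : ℝ, ‖(r : ℂ) * Complex.exp (θ * Complex.I)‖ = r := fun θ => by
    rw [norm_mul, Complex.norm_exp_ofReal_mul_I, mul_one, Complex.norm_real,
      Real.norm_of_nonneg hr0]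
  have hs : Summable fun m : ℕ => ‖(p m : ℂ) * (r : ℂ) ^ m‖ :=
    (h r (by rwa [Complex.norm_real, Real.norm_of_nonneg hr0])).summable.norm
  have key := intervalIntegral.hasSum_integral_of_dominated_convergence
    (μ := MeasureTheory.volume) (a := -π) (b := π)
    (F := fun (m : ℕ) (θ : ℝ) => (p m : ℂ) * ((r : ℂ) * Complex.exp (θ * Complex.I)) ^ m *
      Complex.exp (-(n * θ * Complex.I)))
    (f := fun θ : ℝ => F (r * Complex.exp (θ * Complex.I)) *
      Complex.exp (-(n * θ * Complex.I)))
    (fun m _ => ‖(p m : ℂ) * (r : ℂ) ^ m‖)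
    (fun m => by
      apply Continuous.aestronglyMeasurable
      fun_prop)
    (fun m => .of_forall fun θ _ => by
      have : ‖Complex.exp (-(n * θ * Complex.I))‖ = 1 := by
        rw [Complex.norm_exp]; simp
      rw [norm_mul, this, mul_one, norm_mul, norm_mul, norm_pow, norm_pow, hnorm,
        Complex.norm_real r, Real.norm_of_nonneg hr0])
    (.of_forall fun θ _ => hs)
    (by simp)
    (.of_forall fun θ _ => (h _ (by rw [hnorm]; exact hr1)).mul_right _)
  have hterm : ∀ m : ℕ, ∫ θ in (-π)..π, (p m : ℂ) *
      ((r : ℂ) * Complex.exp (θ * Complex.I)) ^ m * Complex.exp (-(n * θ * Complex.I)) =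
      if m = n then 2 * π * ((p n : ℂ) * (r : ℂ) ^ n) else 0 := by
    intro m
    have e1 : ∀ θ : ℝ, (p m : ℂ) * ((r : ℂ) * Complex.exp (θ * Complex.I)) ^ m *
        Complex.exp (-(n * θ * Complex.I)) = (p m : ℂ) * (r : ℂ) ^ m *
        Complex.exp (((m - n : ℤ) : ℂ) * Complex.I * θ) := by
      intro θ
      rw [mul_pow, ← Complex.exp_nat_mul, mul_assoc, mul_assoc, ← Complex.exp_add, ← mul_assoc]
      congr 2
      push_cast
      ring
    simp_rw [e1]
    rw [intervalIntegral.integral_const_mul, integral_exp_int_mul_I]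
    by_cases hmn : m = n
    · subst hmn
      simp
      ring
    · have : ¬ ((m : ℤ) - n = 0) := by omega
      rw [if_neg this, if_neg hmn, mul_zero]
  simp_rw [hterm] at key
  exact key.unique (hasSum_ite_eq n _)

/-- The exponent `Φ(e^{-t + iθ}) - Φ(e^{-t}) - i θ ρ Φ'(ρ)` of the normalised Cauchy integrand. -/
def cauchyExponent (lam mu t θ : ℝ) : ℂ :=
  (∑' i, ((tripleCoeff lam mu i * Real.exp (-(tripleDeg i * t)) : ℝ) : ℂ) *
    Complex.exp ((tripleDeg i * θ : ℝ) * Complex.I)) -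
  momentSum lam mu 0 (Real.exp (-t)) - momentSum lam mu 1 (Real.exp (-t)) * θ * Complex.I

section CauchyExponent

variable (lam mu : ℝ) {t : ℝ}

lemma summable_ofReal_moment (k : ℕ) (ht : 0 < t) : Summable fun i =>
    ((tripleCoeff lam mu i * ((tripleDeg i : ℝ) ^ k * Real.exp (-(tripleDeg i * t))) : ℝ) : ℂ) :=
  Complex.ofRealCLM.summable (summable_moment lam mu k ht)

lemma ofReal_momentSum (k : ℕ) : (momentSum lam mu k (Real.exp (-t)) : ℂ) = ∑' i,
    ((tripleCoeff lam mu i * ((tripleDeg i : ℝ) ^ k * Real.exp (-(tripleDeg i * t))) : ℝ) : ℂ) := by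
  rw [momentSum_exp_neg, Complex.ofReal_tsum]

lemma norm_oscillating_term (θ : ℝ) (i : TripleIdx) :
    ‖((tripleCoeff lam mu i * Real.exp (-(tripleDeg i * t)) : ℝ) : ℂ) *
      Complex.exp ((tripleDeg i * θ : ℝ) * Complex.I)‖ =
    |tripleCoeff lam mu i| * ((tripleDeg i : ℝ) ^ 0 * Real.exp (-(tripleDeg i * t))) := by
  rw [norm_mul, Complex.norm_exp_ofReal_mul_I, mul_one, Complex.norm_real, norm_mul,
    Real.norm_eq_abs, Real.norm_of_nonneg (Real.exp_pos _).le, pow_zero, one_mul]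

lemma summable_oscillating (ht : 0 < t) (θ : ℝ) : Summable fun i =>
    ((tripleCoeff lam mu i * Real.exp (-(tripleDeg i * t)) : ℝ) : ℂ) *
      Complex.exp ((tripleDeg i * θ : ℝ) * Complex.I) :=
  Summable.of_norm ((summable_abs_moment lam mu 0 ht).congr fun i =>
    (norm_oscillating_term lam mu θ i).symm)

lemma continuous_cauchyExponent (ht : 0 < t) : Continuous (cauchyExponent lam mu t) := by
  have h : Continuous fun θ : ℝ => ∑' i,
      ((tripleCoeff lam mu i * Real.exp (-(tripleDeg i * t)) : ℝ) : ℂ) *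
      Complex.exp ((tripleDeg i * θ : ℝ) * Complex.I) :=
    continuous_tsum (fun i => by fun_prop) (summable_abs_moment lam mu 0 ht)
      (fun i θ => (norm_oscillating_term lam mu θ i).le)
  unfold cauchyExponent
  fun_prop

lemma norm_cauchyExponent_add_le (ht : 0 < t) (θ : ℝ) :
    ‖cauchyExponent lam mu t θ +
      ((momentSum lam mu 2 (Real.exp (-t)) * θ ^ 2 / 2 : ℝ) : ℂ)‖ ≤
    4 * (∑' i, |tripleCoeff lam mu i| *
      ((tripleDeg i : ℝ) ^ 3 * Real.exp (-(tripleDeg i * t)))) * |θ| ^ 3 := by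
  have s0 := summable_ofReal_moment lam mu 0 ht
  have s1 := summable_ofReal_moment lam mu 1 ht
  have s2 := summable_ofReal_moment lam mu 2 ht
  have so := summable_oscillating lam mu ht θ
  have e : cauchyExponent lam mu t θ +
      ((momentSum lam mu 2 (Real.exp (-t)) * θ ^ 2 / 2 : ℝ) : ℂ) =
      ∑' i, ((tripleCoeff lam mu i * Real.exp (-(tripleDeg i * t)) : ℝ) : ℂ) *
        (Complex.exp ((tripleDeg i * θ : ℝ) * Complex.I) - 1 - (tripleDeg i * θ : ℝ) * Complex.I +
          ((tripleDeg i * θ : ℝ) : ℂ) ^ 2 / 2) := by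
    have e2 : ((momentSum lam mu 2 (Real.exp (-t)) * θ ^ 2 / 2 : ℝ) : ℂ) =
        (momentSum lam mu 2 (Real.exp (-t)) : ℂ) * ((θ : ℂ) ^ 2 / 2) := by push_cast; ring
    rw [e2, cauchyExponent, mul_assoc (momentSum lam mu 1 (Real.exp (-t)) : ℂ)]
    simp only [ofReal_momentSum]
    rw [← tsum_mul_right, ← tsum_mul_right, ← so.tsum_sub s0,
      ← (so.sub s0).tsum_sub (s1.mul_right _),
      ← ((so.sub s0).sub (s1.mul_right _)).tsum_add (s2.mul_right _)]
    refine tsum_congr fun i => ?_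
    push_cast
    ring
  rw [e, ← tsum_mul_left, ← tsum_mul_right]
  refine tsum_of_norm_bounded (((summable_abs_moment lam mu 3 ht).mul_left 4).mul_right
    (|θ| ^ 3)).hasSum fun i => ?_
  have h := norm_exp_I_sub_taylor_le (tripleDeg i * θ)
  rw [abs_mul, mul_pow, Nat.abs_cast] at h
  rw [norm_mul, Complex.norm_real, norm_mul, Real.norm_eq_abs,
    Real.norm_of_nonneg (Real.exp_pos _).le]
  calc _ ≤ |tripleCoeff lam mu i| * Real.exp (-(tripleDeg i * t)) *
        (4 * ((tripleDeg i : ℝ) ^ 3 * |θ| ^ 3)) := by gcongr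
    _ = _ := by ring

lemma re_cauchyExponent (ht : 0 < t) (θ : ℝ) :
    (cauchyExponent lam mu t θ).re = -∑' i, tripleCoeff lam mu i *
      ((1 - Real.cos (tripleDeg i * θ)) * Real.exp (-(tripleDeg i * t))) := by
  have so := summable_oscillating lam mu ht θ
  have hre : (∑' i, ((tripleCoeff lam mu i * Real.exp (-(tripleDeg i * t)) : ℝ) : ℂ) *
      Complex.exp ((tripleDeg i * θ : ℝ) * Complex.I)).re =
      ∑' i, tripleCoeff lam mu i * Real.exp (-(tripleDeg i * t)) *
        Real.cos (tripleDeg i * θ) := by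
    rw [Complex.re_tsum so]
    refine tsum_congr fun i => ?_
    rw [Complex.re_ofReal_mul, Complex.exp_ofReal_mul_I_re]
  have sre : Summable fun i => tripleCoeff lam mu i * Real.exp (-(tripleDeg i * t)) *
        Real.cos (tripleDeg i * θ) := by
    refine (Complex.reCLM.summable so).congr fun i => ?_
    rw [Complex.reCLM_apply, Complex.re_ofReal_mul, Complex.exp_ofReal_mul_I_re]
  have him : ((momentSum lam mu 1 (Real.exp (-t)) : ℂ) * θ * Complex.I).re = 0 := by
    simp
  rw [cauchyExponent, Complex.sub_re, Complex.sub_re, hre, him, Complex.ofReal_re, sub_zero,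
    momentSum_exp_neg, ← sre.tsum_sub (summable_moment lam mu 0 ht), ← tsum_neg]
  refine tsum_congr fun i => ?_
  ring

lemma integral_exp_cauchyExponent (ht : 0 < t) {p : ℕ → ℝ}
    (hgen : ∀ z : ℂ, ‖z‖ < 1 →
      HasSum (fun n : ℕ => (p n : ℂ) * z ^ n)
        (Complex.exp ((lam : ℂ) * PhiP2C z + (mu : ℂ) * PhiPsqC z)))
    {n : ℕ} (hn : (n : ℝ) = momentSum lam mu 1 (Real.exp (-t))) :
    ∫ θ in (-π)..π, Complex.exp (cauchyExponent lam mu t θ) =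
      ((2 * π * (p n * Real.exp (-t) ^ n) * Real.exp (-momentSum lam mu 0 (Real.exp (-t))) : ℝ) :
        ℂ) := by
  have key := integral_mul_exp_eq_coeff hgen (Real.exp_pos (-t)).le
    (Real.exp_lt_one_iff.2 (by linarith)) n
  have e : ∀ θ : ℝ, Complex.exp (cauchyExponent lam mu t θ) =
      (Complex.exp ((lam : ℂ) * PhiP2C (Real.exp (-t) * Complex.exp (θ * Complex.I)) +
        (mu : ℂ) * PhiPsqC (Real.exp (-t) * Complex.exp (θ * Complex.I))) *
      Complex.exp (-(n * θ * Complex.I))) *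
      (Real.exp (-momentSum lam mu 0 (Real.exp (-t))) : ℂ) := by
    intro θ
    have hz : ‖(Real.exp (-t) : ℂ) * Complex.exp (θ * Complex.I)‖ = Real.exp (-t) := by
      rw [norm_mul, Complex.norm_exp_ofReal_mul_I, mul_one, Complex.norm_real,
        Real.norm_of_nonneg (Real.exp_pos _).le]
    rw [phiC_eq_tsum lam mu ht hz, Complex.ofReal_exp (-momentSum _ _ _ _),
      ← Complex.exp_add, ← Complex.exp_add, cauchyExponent, ← hn]
    congr 1
    have hterm : ∀ i, (tripleCoeff lam mu i : ℂ) *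
        ((Real.exp (-t) : ℂ) * Complex.exp (θ * Complex.I)) ^ tripleDeg i =
        ((tripleCoeff lam mu i * Real.exp (-(tripleDeg i * t)) : ℝ) : ℂ) *
          Complex.exp ((tripleDeg i * θ : ℝ) * Complex.I) := by
      intro i
      rw [Complex.ofReal_exp (-t), mul_pow, ← Complex.exp_nat_mul, ← Complex.exp_nat_mul,
        Complex.ofReal_mul, mul_assoc, Complex.ofReal_exp]
      congr 3 <;> push_cast <;> ring
    simp_rw [hterm]
    push_cast
    ring
  simp_rw [e]
  rw [intervalIntegral.integral_mul_const, key]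
  push_cast
  ring

end CauchyExponent

/-- Relative error of the saddle-point approximation, in terms of `t = -log ρ`. -/
lemma eventually_abs_saddle_sub_one_le {lam : ℝ} (mu : ℝ) (hlam : 0 < lam) :
    ∀ᶠ t : ℝ in 𝓝[>] 0, 0 < momentSum lam mu 2 (Real.exp (-t)) ∧
    ∀ p : ℕ → ℝ, (∀ z : ℂ, ‖z‖ < 1 →
      HasSum (fun n : ℕ => (p n : ℂ) * z ^ n)
        (Complex.exp ((lam : ℂ) * PhiP2C z + (mu : ℂ) * PhiPsqC z))) →
    ∀ n : ℕ, (n : ℝ) = momentSum lam mu 1 (Real.exp (-t)) →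
    |p n * Real.exp (-t) ^ n * Real.exp (-momentSum lam mu 0 (Real.exp (-t))) *
      √(2 * π * momentSum lam mu 2 (Real.exp (-t))) - 1| ≤ t ^ (2 / 5 : ℝ) := by
  obtain ⟨C2, hC2, h2⟩ := exists_tsum_abs_moment_le lam mu 2
  obtain ⟨C3, hC3, h3⟩ := exists_tsum_abs_moment_le lam mu 3
  have hpi := Real.pi_pos
  filter_upwards [eventually_le_second_moment mu hlam, eventually_le_tsum_one_sub_cos mu hlam,
    self_mem_nhdsWithin, eventually_mul_rpow_neg_le (a := 0) (b := 1) (by norm_num) 1,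
    eventually_mul_rpow_neg_le (a := 301 / 100) (b := 4) (by norm_num) C2,
    eventually_mul_rpow_neg_le (a := 298 / 100) (b := 299 / 100) (by norm_num) (16 * C3),
    eventually_mul_rpow_neg_le (a := -(19 / 40)) (b := -(2 / 5)) (by norm_num)
      (32 * (4 * C3 + 1) + √(2 * π) * (5 : ℝ) ^ (5 : ℝ))]
    with t hS hM ht b1 b2 b3 b4
  have ht0 : (0 : ℝ) < t := ht
  rw [neg_zero, Real.rpow_zero, one_mul, Real.rpow_neg_one] at b1
  have ht1 : t ≤ 1 := by
    have := mul_le_mul_of_nonneg_left b1 ht0.le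
    rwa [mul_one, mul_inv_cancel₀ ht0.ne'] at this
  rw [neg_neg, neg_neg] at b4
  rw [← momentSum_exp_neg] at hS
  set S := momentSum lam mu 2 (Real.exp (-t)) with hSdef
  have hSpos : 0 < S := lt_of_lt_of_le (by positivity) hS
  refine ⟨hSpos, fun p hgen n hn => ?_⟩
  have hSup : S ≤ t ^ (-(4 : ℝ)) := by
    have e1 : S ≤ ∑' i, |tripleCoeff lam mu i| *
        ((tripleDeg i : ℝ) ^ 2 * Real.exp (-(tripleDeg i * t))) := by
      rw [hSdef, momentSum_exp_neg]
      refine (summable_moment lam mu 2 ht0).tsum_le_tsum (fun i => ?_) (h2 t ht0).1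
      gcongr
      exact le_abs_self _
    have e2 := (h2 t ht0).2
    norm_num at e2
    norm_num at b2
    norm_num
    linarith
  set σ := √S with hσdef
  have hσ : 0 < σ := Real.sqrt_pos.2 hSpos
  have hσ2 : σ ^ 2 = S := Real.sq_sqrt hSpos.le
  have hσup : σ ≤ t ^ (-(2 : ℝ)) := by
    rw [hσdef, Real.sqrt_le_left (by positivity), ← Real.rpow_natCast, ← Real.rpow_mul ht0.le]
    convert hSup using 2
    norm_num
  have hσlow : t ^ (-(299 / 200 : ℝ)) ≤ σ := by
    apply Real.le_sqrt_of_sq_le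
    rw [← Real.rpow_natCast, ← Real.rpow_mul ht0.le]
    convert hS using 2
    norm_num
  set T3 := ∑' i, |tripleCoeff lam mu i| *
      ((tripleDeg i : ℝ) ^ 3 * Real.exp (-(tripleDeg i * t))) with hT3
  have hT30 : 0 ≤ T3 := tsum_nonneg fun i => by positivity
  have hT3up : T3 ≤ C3 * t ^ (-(401 / 100 : ℝ)) := by
    convert (h3 t ht0).2 using 3
    norm_num
  set δ := t ^ (103 / 100 : ℝ) with hδdef
  have hδ : 0 < δ := by positivity
  have hδ1 : δ ≤ 1 := Real.rpow_le_one ht0.le ht1 (by norm_num)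
  have key := norm_integral_exp_sub_gaussian_le (cauchyExponent lam mu t)
    (continuous_cauchyExponent lam mu ht0) (σ := σ) (B := 4 * T3) (δ := δ)
    (M := t ^ (-(4 / 5 : ℝ))) hσ (by positivity) hδ (by linarith [Real.pi_gt_three])
    (by
      rw [hσ2]
      calc 4 * T3 * δ ≤ 4 * (C3 * t ^ (-(401 / 100 : ℝ))) * δ := by gcongr
        _ = 4 * C3 * (t ^ (-(401 / 100 : ℝ)) * δ) := by ring
        _ = 4 * C3 * t ^ (-(298 / 100 : ℝ)) := by
          rw [hδdef, ← Real.rpow_add ht0]; norm_num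
        _ ≤ S / 4 := by linarith)
    (fun θ _ => by
      rw [hσ2]
      exact norm_cauchyExponent_add_le lam mu ht0 θ)
    (fun θ hθ1 hθ2 => by
      rw [re_cauchyExponent lam mu ht0]
      exact neg_le_neg (hM θ hθ1 hθ2))
  rw [integral_exp_cauchyExponent lam mu ht0 hgen hn, ← Complex.ofReal_sub, Complex.norm_real,
    Real.norm_eq_abs] at key
  set P := p n * Real.exp (-t) ^ n * Real.exp (-momentSum lam mu 0 (Real.exp (-t))) with hP
  have hq : 0 < √(2 * π) := Real.sqrt_pos.2 (by positivity)
  have hq2 : √(2 * π) ^ 2 = 2 * π := Real.sq_sqrt (by positivity)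
  have hq8 : √(8 * π) = 2 * √(2 * π) := by
    rw [show 8 * π = 2 ^ 2 * (2 * π) by ring, Real.sqrt_mul (by positivity),
      Real.sqrt_sq (by norm_num)]
  set q := √(2 * π) with hqdef
  have hmain : |P * √(2 * π * S) - 1| ≤
      32 * ((4 * T3 + (δ ^ 3)⁻¹) / σ ^ 3) +
        q * (σ * Real.exp (-t ^ (-(4 / 5 : ℝ)))) := by
    have e1 : P * √(2 * π * S) - 1 = (2 * π * (p n * Real.exp (-t) ^ n) *
        Real.exp (-momentSum lam mu 0 (Real.exp (-t))) - q / σ) * (σ / q) := by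
      rw [Real.sqrt_mul (by positivity), ← hqdef, hP, ← hσdef, sub_mul]
      congr 1
      · rw [← hq2]; field_simp
      · field_simp
    rw [e1, abs_mul, abs_of_pos (by positivity : 0 < σ / q)]
    refine (mul_le_mul_of_nonneg_right key (by positivity)).trans (le_of_eq ?_)
    rw [hq8, ← hq2]
    field_simp
    ring
  refine hmain.trans ?_
  have hσ3 : (σ ^ 3)⁻¹ ≤ t ^ (897 / 200 : ℝ) := by
    rw [inv_le_comm₀ (by positivity) (by positivity), ← Real.rpow_neg ht0.le]
    calc t ^ (-(897 / 200) : ℝ) = (t ^ (-(299 / 200 : ℝ))) ^ 3 := by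
          rw [← Real.rpow_natCast, ← Real.rpow_mul ht0.le]; norm_num
      _ ≤ σ ^ 3 := by gcongr
  have hδ3 : (δ ^ 3)⁻¹ ≤ t ^ (-(401 / 100 : ℝ)) := by
    rw [hδdef, ← Real.rpow_natCast, ← Real.rpow_mul ht0.le, ← Real.rpow_neg ht0.le]
    exact Real.rpow_le_rpow_of_exponent_ge ht0 ht1 (by norm_num)
  have hfirst : (4 * T3 + (δ ^ 3)⁻¹) / σ ^ 3 ≤ (4 * C3 + 1) * t ^ (19 / 40 : ℝ) := by
    calc (4 * T3 + (δ ^ 3)⁻¹) / σ ^ 3 = (4 * T3 + (δ ^ 3)⁻¹) * (σ ^ 3)⁻¹ := div_eq_mul_inv _ _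
      _ ≤ (4 * (C3 * t ^ (-(401 / 100 : ℝ))) + t ^ (-(401 / 100 : ℝ))) * t ^ (897 / 200 : ℝ) := by
        gcongr
      _ = (4 * C3 + 1) * (t ^ (-(401 / 100 : ℝ)) * t ^ (897 / 200 : ℝ)) := by ring
      _ = _ := by rw [← Real.rpow_add ht0]; norm_num
  have hsecond : σ * Real.exp (-t ^ (-(4 / 5 : ℝ))) ≤ (5 : ℝ) ^ (5 : ℝ) * t ^ (19 / 40 : ℝ) := by
    have e1 := exp_neg_le_mul_rpow (s := 5) (by norm_num)
      (show 0 < t ^ (-(4 / 5 : ℝ)) by positivity)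
    rw [← Real.rpow_mul ht0.le] at e1
    calc _ ≤ t ^ (-(2 : ℝ)) * ((5 : ℝ) ^ (5 : ℝ) * t ^ (-(4 / 5 : ℝ) * -5)) := by gcongr
      _ = (5 : ℝ) ^ (5 : ℝ) * (t ^ (-(2 : ℝ)) * t ^ (-(4 / 5 : ℝ) * -5)) := by ring
      _ = (5 : ℝ) ^ (5 : ℝ) * t ^ (-(2 : ℝ) + -(4 / 5 : ℝ) * -5) := by rw [← Real.rpow_add ht0]
      _ ≤ _ := by
        gcongr 1
        exact Real.rpow_le_rpow_of_exponent_ge ht0 ht1 (by norm_num)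
  calc _ ≤ 32 * ((4 * C3 + 1) * t ^ (19 / 40 : ℝ)) +
        q * ((5 : ℝ) ^ (5 : ℝ) * t ^ (19 / 40 : ℝ)) := by gcongr
    _ = (32 * (4 * C3 + 1) + q * (5 : ℝ) ^ (5 : ℝ)) * t ^ (19 / 40 : ℝ) := by ring
    _ ≤ _ := b4

lemma exists_momentSum_one_le (lam mu : ℝ) : ∃ C : ℝ, 0 < C ∧ ∀ t : ℝ, 0 < t →
    momentSum lam mu 1 (Real.exp (-t)) ≤ C * t ^ (-(201 / 100 : ℝ)) := by
  obtain ⟨C, hC, h⟩ := exists_tsum_abs_moment_le lam mu 1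
  refine ⟨C, hC, fun t ht => ?_⟩
  have e1 : momentSum lam mu 1 (Real.exp (-t)) ≤ ∑' i, |tripleCoeff lam mu i| *
      ((tripleDeg i : ℝ) ^ 1 * Real.exp (-(tripleDeg i * t))) := by
    rw [momentSum_exp_neg]
    refine (summable_moment lam mu 1 ht).tsum_le_tsum (fun i => ?_) (h t ht).1
    gcongr
    exact le_abs_self _
  have e2 := (h t ht).2
  rw [show ((1 : ℕ) : ℝ) + 101 / 100 = 201 / 100 by norm_num] at e2
  exact e1.trans e2

/-- The saddle point tends to `1`. -/
lemma tendsto_neg_log_saddle (lam mu : ℝ) {ρ : ℕ → ℝ}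
    (hρ : ∀ᶠ n : ℕ in atTop, ρ n ∈ Set.Ioo (0 : ℝ) 1 ∧ (n : ℝ) = momentSum lam mu 1 (ρ n)) :
    Tendsto (fun n => -Real.log (ρ n)) atTop (𝓝[>] 0) := by
  obtain ⟨C, hC, h⟩ := exists_momentSum_one_le lam mu
  refine tendsto_nhdsWithin_iff.2 ⟨tendsto_order.2 ⟨fun a ha => ?_, fun a ha => ?_⟩, ?_⟩
  · filter_upwards [hρ] with n hn
    linarith [Real.log_neg hn.1.1 hn.1.2]
  · filter_upwards [hρ, tendsto_natCast_atTop_atTop.eventually_gt_atTop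
      (C * a ^ (-(201 / 100 : ℝ)))] with n hn hbig
    by_contra! hcon
    have h1 := h _ (ha.trans_le hcon)
    rw [neg_neg, Real.exp_log hn.1.1, ← hn.2] at h1
    have h2 : (-Real.log (ρ n)) ^ (-(201 / 100 : ℝ)) ≤ a ^ (-(201 / 100 : ℝ)) :=
      Real.rpow_le_rpow_of_nonpos ha hcon (by norm_num)
    have := mul_le_mul_of_nonneg_left h2 hC.le
    linarith
  · filter_upwards [hρ] with n hn
    exact neg_pos.2 (Real.log_neg hn.1.1 hn.1.2)

/-- Theorem 7.5 (saddle-point evaluation of the Cauchy integral): let `λ > 0`, `μ ∈ ℝ`,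
`Φ_{λ,μ} = λΦ_{P₂} + μΦ_{P²}`, let `𝔭_{λ,μ}(n)` be the Taylor coefficients of
`Ψ_{λ,μ}(z) = exp(Φ_{λ,μ}(z))` on the unit disc, and let `ρ(n) ∈ (0,1)` solve
`n = ρΦ'_{λ,μ}(ρ)`.  Then as `n → ∞`,
`𝔭_{λ,μ}(n) = ρ^{−n}Ψ_{λ,μ}(ρ)/(2πΦ_{λ,μ,(2)}(ρ))^{1/2} (1 + O(n^{−1/6}))`,
with `Φ_{λ,μ,(2)}(ρ) = (ρ d/dρ)²Φ_{λ,μ}(ρ)`. -/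
theorem saddle_point_partition_formula (lam mu : ℝ) (hlam : 0 < lam)
    (p : ℕ → ℝ) (ρ : ℕ → ℝ)
    (hgen : ∀ z : ℂ, ‖z‖ < 1 →
      HasSum (fun n : ℕ => (p n : ℂ) * z ^ n)
        (Complex.exp ((lam : ℂ) * PhiP2C z + (mu : ℂ) * PhiPsqC z)))
    (hρ : ∀ᶠ n : ℕ in atTop, ρ n ∈ Set.Ioo (0:ℝ) 1 ∧
      (n : ℝ) = ρ n * deriv (fun r => lam * PhiP2 r + mu * PhiPsq r) (ρ n)) :
    ∃ E : ℕ → ℝ,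
      (E =O[atTop] fun n : ℕ => (n : ℝ) ^ (-(1:ℝ)/6)) ∧
      ∀ᶠ n : ℕ in atTop,
        p n =
          (ρ n) ^ (-(n : ℝ)) *
            Real.exp (lam * PhiP2 (ρ n) + mu * PhiPsq (ρ n)) /
            Real.sqrt (2 * Real.pi *
              (Dop^[2] (fun r => lam * PhiP2 r + mu * PhiPsq r)) (ρ n)) *
            (1 + E n) := by
  have hρ' : ∀ᶠ n : ℕ in atTop, ρ n ∈ Set.Ioo (0 : ℝ) 1 ∧
      (n : ℝ) = momentSum lam mu 1 (ρ n) := by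
    filter_upwards [hρ] with n hn
    exact ⟨hn.1, hn.2.trans (mul_deriv_phi lam mu hn.1)⟩
  have htend := tendsto_neg_log_saddle lam mu hρ'
  obtain ⟨C, hC, hup⟩ := exists_momentSum_one_le lam mu
  refine ⟨fun n => p n * ρ n ^ n * Real.exp (-momentSum lam mu 0 (ρ n)) *
    √(2 * π * momentSum lam mu 2 (ρ n)) - 1, ?_, ?_⟩
  · refine Asymptotics.IsBigO.of_bound 1 ?_
    filter_upwards [hρ', htend.eventually (eventually_abs_saddle_sub_one_le mu hlam),
      htend.eventually (eventually_mul_rpow_neg_le (a := 201 / 100) (b := 12 / 5)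
        (by norm_num) C), eventually_gt_atTop 0] with n hn hE hpow hn0
    have hexp : Real.exp (-(-Real.log (ρ n))) = ρ n := by rw [neg_neg, Real.exp_log hn.1.1]
    have ht0 : 0 < -Real.log (ρ n) := neg_pos.2 (Real.log_neg hn.1.1 hn.1.2)
    have hn1 := hup _ ht0
    rw [hexp] at hE hn1
    have h1 := hE.2 p hgen n hn.2
    have hn0' : (0 : ℝ) < n := by exact_mod_cast hn0
    rw [Real.norm_eq_abs, one_mul, Real.norm_of_nonneg (by positivity)]
    refine h1.trans ?_
    rw [← hn.2] at hn1
    calc (-Real.log (ρ n)) ^ (2 / 5 : ℝ) =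
          ((-Real.log (ρ n)) ^ (-(12 / 5) : ℝ)) ^ (-(1 : ℝ) / 6) := by
          rw [← Real.rpow_mul ht0.le]; norm_num
      _ ≤ (n : ℝ) ^ (-(1 : ℝ) / 6) :=
        Real.rpow_le_rpow_of_nonpos hn0' (hn1.trans hpow) (by norm_num)
  · filter_upwards [hρ', htend.eventually (eventually_abs_saddle_sub_one_le mu hlam)]
      with n hn hE
    have hexp : Real.exp (-(-Real.log (ρ n))) = ρ n := by rw [neg_neg, Real.exp_log hn.1.1]
    rw [hexp] at hE
    have hpi := Real.pi_pos
    have hS : 0 < √(2 * π * momentSum lam mu 2 (ρ n)) := by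
      have := hE.1
      positivity
    have hρn : 0 < ρ n ^ n := pow_pos hn.1.1 n
    rw [dop_dop_phi lam mu hn.1, phi_eq_momentSum lam mu hn.1, Real.rpow_neg hn.1.1.le,
      Real.rpow_natCast, Real.exp_neg]
    have := Real.exp_pos (momentSum lam mu 0 (ρ n))
    field_simp
    ring

end
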